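/- arXiv:1402.4053 — 4 statements merged into one kernel-verified Lean document; each statement's English description precedes it below -/
import Mathlib

section
/- Let n ≥ 2, k ≥ 1, and r_1,…,r_k ≥ 1. (a) If k ≥ n+1, then there is a polynomial q, not identically zero, in the entries of a tuple (P_1,…,P_k) ∈ ℝ^{r_1×n}×⋯×ℝ^{r_k×n}, such that for every tuple with q(P_1,…,P_k) ≠ 0 the set of z ∈ ℝ^n that are NOT identifiable up to sign from the measurements b_i = ‖P_i z‖², 1 ≤ i ≤ k, has Lebesgue measure zero. (b) If k ≤ n, then there is a polynomial q, not identically zero, in the entries of the tuple, such that for every tuple with q(P_1,…,P_k) ≠ 0 the set of z ∈ ℝ^n that ARE identifiable up to sign from the b_i has Lebesgue measure zero. That is, generic linear measurements identify generic real signals up to sign if and only if k ≥ n+1. -/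
open Matrix MeasureTheory

/-- `z ∈ ℝ^n` is identifiable up to sign from the measurements `b_i = ‖P_i z‖²`:
every `w` with `‖P_i w‖² = ‖P_i z‖²` for all `i` satisfies `w = z` or `w = -z`. -/
def IdUpToSign {n k : ℕ} {r : Fin k → ℕ}
    (P : ∀ i : Fin k, Matrix (Fin (r i)) (Fin n) ℝ) (z : Fin n → ℝ) : Prop :=
  ∀ w : Fin n → ℝ,
    (∀ i : Fin k,
      ((P i).mulVec w) ⬝ᵥ ((P i).mulVec w) = ((P i).mulVec z) ⬝ᵥ ((P i).mulVec z)) →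
    w = z ∨ w = -z


lemma null_zeros : ∀ (n : ℕ) (p : MvPolynomial (Fin n) ℝ), p ≠ 0 →
    volume {z : Fin n → ℝ | MvPolynomial.eval z p = 0} = 0 := by
  intro n
  induction n with
  | zero =>
    intro p hp
    have : {z : Fin 0 → ℝ | MvPolynomial.eval z p = 0} = ∅ := by
      ext z
      simp only [Set.mem_ofPred_eq, Set.mem_empty_iff_false, iff_false]
      intro h
      apply hp
      apply MvPolynomial.funext
      intro x
      rw [Subsingleton.elim x z, h, map_zero]
    rw [this, measure_empty]
  | succ n ih =>
    intro p hp
    have hmeas : ∀ (m : ℕ) (p : MvPolynomial (Fin m) ℝ),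
        MeasurableSet {z : Fin m → ℝ | MvPolynomial.eval z p = 0} := fun m p =>
      (isClosed_eq (MvPolynomial.continuous_eval p) continuous_const).measurableSet
    have hmp := (volume_preserving_piFinSuccAbove (fun _ : Fin (n+1) => ℝ) 0).symm
    rw [← hmp.measure_preimage (hmeas _ _).nullMeasurableSet]
    rw [Measure.volume_eq_prod, Measure.measure_prod_null (hmp.measurable (hmeas _ _))]
    have hfin : {a : ℝ | Polynomial.eval (MvPolynomial.C a)
        (MvPolynomial.finSuccEquiv ℝ n p) = 0}.Finite := by
      have h0 : MvPolynomial.finSuccEquiv ℝ n p ≠ 0 := by simpa using hp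
      have := (MvPolynomial.finSuccEquiv ℝ n p).roots.toFinset.finite_toSet
      refine Set.Finite.subset
        (this.preimage (MvPolynomial.C_injective (Fin n) ℝ).injOn) ?_
      intro a ha
      simpa [h0] using ha
    have hae : ∀ᵐ a : ℝ, a ∉ {a : ℝ | Polynomial.eval (MvPolynomial.C a)
        (MvPolynomial.finSuccEquiv ℝ n p) = 0} :=
      measure_eq_zero_iff_ae_notMem.mp (hfin.measure_zero _)
    filter_upwards [hae] with a ha
    have := ih _ ha
    rw [Pi.zero_apply]
    convert this using 2
    ext y
    simp only [Set.mem_preimage, Set.mem_ofPred_eq]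
    rw [show (MeasurableEquiv.piFinSuccAbove (fun _ : Fin (n+1) => ℝ) 0).symm (a, y)
      = Fin.cons a y from by ext i; simp [MeasurableEquiv.piFinSuccAbove]]
    rw [MvPolynomial.eval_eq_eval_mv_eval', Polynomial.eval_map, Polynomial.eval,
      Polynomial.hom_eval₂]
    simp [Polynomial.eval₂_eq_eval_map]

open Polynomial in
lemma odd_root (p : Polynomial ℝ) (hp : p.Monic) (hodd : Odd p.natDegree) : ∃ x, p.eval x = 0 := by
  have hpos : 0 < p.natDegree := hodd.pos
  have hdeg : 0 < p.degree := natDegree_pos_iff_degree_pos.mp hpos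
  have h1 := p.tendsto_atTop_of_leadingCoeff_nonneg hdeg (by rw [hp.leadingCoeff]; norm_num)
  have hnd : (p.comp (-X)).natDegree = p.natDegree := by simp [natDegree_comp]
  have h2 := (-(p.comp (-X))).tendsto_atTop_of_leadingCoeff_nonneg
    (by rw [degree_neg]; exact natDegree_pos_iff_degree_pos.mp (by rw [hnd]; exact hpos))
    (by
      rw [leadingCoeff_neg, leadingCoeff_comp (by simp)]
      simp [hp.leadingCoeff, hodd.neg_one_pow])
  obtain ⟨a, ha⟩ := (h1.eventually_ge_atTop 0).exists
  obtain ⟨b, hb⟩ := (h2.eventually_ge_atTop 0).exists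
  simp at hb
  obtain ⟨c, hc⟩ := mem_range_of_exists_le_of_exists_ge p.continuous ⟨-b, hb⟩ ⟨a, ha⟩
  exact ⟨c, hc⟩

open Polynomial in
lemma even_root (p : Polynomial ℝ) (hp : p.Monic) (heven : Even p.natDegree) (a : ℝ)
    (ha : p.eval a = 0) (ha' : p.derivative.eval a ≠ 0) : ∃ x, p.eval x = 0 ∧ x ≠ a := by
  obtain ⟨g, rfl⟩ := dvd_iff_isRoot.mpr ha
  have hg : g.Monic := (monic_X_sub_C a).of_mul_monic_left hp
  rw [(monic_X_sub_C a).natDegree_mul hg, natDegree_X_sub_C] at heven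
  have hodd : Odd g.natDegree := by
    rcases Nat.even_or_odd g.natDegree with h | h
    · exact absurd heven (by rw [Nat.not_even_iff_odd]; exact odd_one.add_even h)
    · exact h
  obtain ⟨b, hb⟩ := odd_root g hg hodd
  refine ⟨b, by simp [hb], ?_⟩
  rintro rfl
  apply ha'
  simp [hb]

lemma rank_one {n : ℕ} (Y : Fin n → Fin n → ℝ) (hs : ∀ i j, Y i j = Y j i)
    (hr : ∀ i j k l, Y i j * Y k l = Y i l * Y k j) (h0 : ∃ i j, Y i j ≠ 0) :
    ∃ (s : ℝ) (v : Fin n → ℝ), s ≠ 0 ∧ ∀ i j, Y i j = s * v i * v j := by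
  obtain ⟨i, j, hij⟩ := h0
  have hii : Y i i ≠ 0 := by
    intro h
    have := hr i i j j
    rw [h, hs j i, zero_mul] at this
    exact hij (by simpa using this.symm)
  refine ⟨Y i i, fun a => Y i a / Y i i, hii, fun a b => ?_⟩
  have := hr i i a b
  rw [hs a i] at this
  field_simp
  linarith

lemma deriv_x_zero {K L M : Type*} [Field K] [Field L] [CharZero L] [Algebra K L] [AddCommGroup M]
    [Module L M] [Module K M] {n : ℕ}
    (a : Fin n → Fin n → Fin n → K) (hsym : ∀ i j l, a i j l = a i l j)
    (x : Fin n → L) (c : Fin n → K)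
    (h : ∀ i, ∑ j, ∑ l, algebraMap K L (a i j l) * x j * x l = algebraMap K L (c i))
    (hdet : (Matrix.of fun i j => ∑ l, algebraMap K L (a i j l) * x l).det ≠ 0)
    (D : Derivation K L M) (j : Fin n) : D (x j) = 0 := by
  set J : Matrix (Fin n) (Fin n) L := Matrix.of fun i j => ∑ l, algebraMap K L (a i j l) * x l
    with hJ
  have key : ∀ i, ∑ j, J i j • D (x j) = 0 := by
    intro i
    have h1 := congrArg D (h i)
    rw [Derivation.map_algebraMap, map_sum] at h1
    simp only [map_sum, Derivation.leibniz, Derivation.map_algebraMap, smul_add, smul_smul,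
      smul_zero, add_zero, Finset.sum_add_distrib, mul_assoc] at h1
    have h2 : ∑ j, ∑ l, (algebraMap K L (a i j l) * x j) • D (x l) = ∑ j, J i j • D (x j) := by
      rw [Finset.sum_comm]
      refine Finset.sum_congr rfl fun l _ => ?_
      simp only [hJ, Matrix.of_apply, Finset.sum_smul]
      refine Finset.sum_congr rfl fun j _ => ?_
      rw [hsym]
    have h3 : ∑ j, ∑ l, (algebraMap K L (a i j l) * x l) • D (x j) = ∑ j, J i j • D (x j) := by
      refine Finset.sum_congr rfl fun l _ => ?_
      simp only [hJ, Matrix.of_apply, Finset.sum_smul]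
    rw [h2, h3, ← two_smul L] at h1
    exact (smul_eq_zero.mp h1).resolve_left two_ne_zero
  have hinv : J⁻¹ * J = 1 := Matrix.nonsing_inv_mul _ (isUnit_iff_ne_zero.mpr hdet)
  calc D (x j) = ∑ l, (1 : Matrix (Fin n) (Fin n) L) j l • D (x l) := by
        simp [Matrix.one_apply, ite_smul]
    _ = ∑ l, ∑ i, (J⁻¹ j i * J i l) • D (x l) := by
        rw [← hinv]; simp [Matrix.mul_apply, Finset.sum_smul]
    _ = ∑ i, J⁻¹ j i • ∑ l, J i l • D (x l) := by
        rw [Finset.sum_comm]; simp [Finset.smul_sum, smul_smul]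
    _ = 0 := by simp [key]

lemma alg_of_jac {Ω : Type} [Field Ω] [Algebra ℝ Ω] {n : ℕ} (K : IntermediateField ℝ Ω)
    (a : Fin n → Fin n → Fin n → Ω) (ha : ∀ i j l, a i j l ∈ K)
    (hsym : ∀ i j l, a i j l = a i l j)
    (x : Fin n → Ω) (h : ∀ i, ∑ j, ∑ l, a i j l * x j * x l ∈ K)
    (hdet : (Matrix.of fun i j => ∑ l, a i j l * x l).det ≠ 0) (j : Fin n) :
    IsAlgebraic K (x j) := by
  have : CharZero Ω := charZero_of_injective_algebraMap (algebraMap ℝ Ω).injective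
  have : CharZero K := charZero_of_injective_algebraMap (algebraMap ℝ K).injective
  let L := IntermediateField.adjoin K (Set.range x)
  have : CharZero L := charZero_of_injective_algebraMap (algebraMap K L).injective
  have hx : ∀ j, x j ∈ L := fun j => IntermediateField.subset_adjoin _ _ ⟨j, rfl⟩
  let x' : Fin n → L := fun j => ⟨x j, hx j⟩
  let a' : Fin n → Fin n → Fin n → K := fun i j l => ⟨a i j l, ha i j l⟩
  let c : Fin n → K := fun i => ⟨_, h i⟩
  have hD : ∀ j, KaehlerDifferential.D K L (x' j) = 0 := by
    apply deriv_x_zero a' (fun i j l => Subtype.ext (hsym i j l)) x' c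
    · intro i
      apply Subtype.ext
      simp [a', x', c]
    · intro h0
      apply hdet
      have := congrArg (algebraMap L Ω) h0
      rw [RingHom.map_det, map_zero] at this
      rw [← this]
      congr 1
      ext i j
      simp [a', x']
  have hall : ∀ y : Ω, ∀ hy : y ∈ L, KaehlerDifferential.D K L ⟨y, hy⟩ = 0 := by
    intro y hy
    refine IntermediateField.adjoin_induction (F := K) (s := Set.range x)
      (p := fun y hy => KaehlerDifferential.D K L ⟨y, hy⟩ = 0) ?_ ?_ ?_ ?_ ?_ hy
    · rintro _ ⟨j, rfl⟩
      exact hD j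
    · intro k
      exact Derivation.map_algebraMap _ k
    · intro y z hy hz h1 h2
      have := (KaehlerDifferential.D K L).map_add ⟨y, hy⟩ ⟨z, hz⟩
      rw [h1, h2, add_zero] at this
      exact this
    · intro y hy h1
      have := (KaehlerDifferential.D K L).leibniz_inv ⟨y, hy⟩
      rw [h1, smul_zero] at this
      exact this
    · intro y z hy hz h1 h2
      have := (KaehlerDifferential.D K L).leibniz ⟨y, hy⟩ ⟨z, hz⟩
      rw [h1, h2, smul_zero, smul_zero, add_zero] at this
      exact this
  have : Algebra.EssFiniteType K L :=
    IntermediateField.essFiniteType_iff.mpr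
      (IntermediateField.fg_adjoin_of_finite (Set.finite_range x))
  have : Algebra.FormallyUnramified K L := by
    constructor
    rw [← Submodule.subsingleton_iff L, ← subsingleton_iff_bot_eq_top,
      ← KaehlerDifferential.span_range_derivation, eq_comm, Submodule.span_eq_bot]
    rintro _ ⟨y, rfl⟩
    exact hall y.1 y.2
  have := Algebra.FormallyUnramified.isSeparable K L
  have := (Algebra.IsSeparable.isAlgebraic K L).isAlgebraic (x' j)
  exact this.algHom L.val

open Polynomial in
lemma prim_elt {C Ω ι : Type} [CommRing C] [IsDomain C] [IsIntegrallyClosed C] [CharZero C]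
    [Field Ω] [Fintype ι] (φ : C →+* Ω) (hφ : Function.Injective φ) (X : ι → Ω)
    (hX : ∀ i, ∃ p : C[X], p ≠ 0 ∧ p.eval₂ φ (X i) = 0) :
    ∃ (m : C[X]) (D : C) (N : ι → C[X]) (t : ι → C), m.Monic ∧ D ≠ 0 ∧
      m.derivative.eval₂ φ (∑ i, φ (t i) * X i) ≠ 0 ∧
      (∀ i, φ D * X i = (N i).eval₂ φ (∑ i, φ (t i) * X i)) ∧
      (∀ G : C[X], G.eval₂ φ (∑ i, φ (t i) * X i) = 0 ↔ m ∣ G) := by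
  let : Algebra C Ω := φ.toAlgebra
  have : FaithfulSMul C Ω := (faithfulSMul_iff_algebraMap_injective C Ω).mpr hφ
  let K := FractionRing C
  let : Algebra K Ω := FractionRing.liftAlgebra C Ω
  have : IsScalarTower C K Ω := FractionRing.isScalarTower_liftAlgebra C Ω
  have : CharZero K := charZero_of_injective_algebraMap (IsFractionRing.injective C K)
  have hφa : ∀ c, φ c = algebraMap C Ω c := fun c => rfl
  have hXa : ∀ i, IsAlgebraic C (X i) := hX
  have hXi : ∀ i, IsIntegral K (X i) := fun i =>
    ((IsFractionRing.isAlgebraic_iff C K Ω).mp (hXa i)).isIntegral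
  let L := IntermediateField.adjoin K (Set.range X)
  have : FiniteDimensional K L :=
    IntermediateField.finiteDimensional_adjoin (by rintro _ ⟨i, rfl⟩; exact hXi i)
  have : Finite (IntermediateField K L) :=
    Field.finite_intermediateField_of_exists_primitive_element K L
      (Field.exists_primitive_element K L)
  have hXL : ∀ i, X i ∈ L := fun i => IntermediateField.subset_adjoin _ _ ⟨i, rfl⟩
  let X' : ι → L := fun i => ⟨X i, hXL i⟩
  let V : Submodule K L := Submodule.span K (Set.range X')
  classical
  let := Fintype.ofFinite (IntermediateField K L)
  let s : Finset (Subspace K V) := ((Finset.univ : Finset (IntermediateField K L)).image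
    (fun M => (M.toSubalgebra.toSubmodule).comap V.subtype)).erase ⊤
  have hs : ⊤ ∉ s := Finset.notMem_erase _ _
  have hne := Subspace.biUnion_ne_univ_of_top_notMem hs
  obtain ⟨θ0, hθ0⟩ := (Set.ne_univ_iff_exists_notMem _).mp hne
  have hprim : ∀ i, X' i ∈ IntermediateField.adjoin K {(θ0 : L)} := by
    intro i
    by_contra hi
    apply hθ0
    simp only [Set.mem_iUnion]
    refine ⟨((IntermediateField.adjoin K {(θ0 : L)}).toSubalgebra.toSubmodule).comap V.subtype,
      ?_, ?_⟩
    · refine Finset.mem_erase.mpr ⟨fun htop => hi ?_, Finset.mem_image_of_mem _ (Finset.mem_univ _)⟩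
      have : (⟨X' i, Submodule.subset_span ⟨i, rfl⟩⟩ : V) ∈ (⊤ : Subspace K V) := trivial
      rw [← htop] at this
      exact this
    · exact IntermediateField.mem_adjoin_simple_self K (θ0 : L)
  obtain ⟨cf, hcf⟩ := (Submodule.mem_span_range_iff_exists_fun K).mp θ0.2
  obtain ⟨b, hb⟩ := IsLocalization.exist_integer_multiples_of_finite (nonZeroDivisors C) cf
  choose t0 ht0 using hb
  have hb0 : (b : C) ≠ 0 := nonZeroDivisors.ne_zero b.2
  have hθ1 : ∑ i, φ (t0 i) * X i = algebraMap C Ω b * ((θ0 : L) : Ω) := by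
    rw [← hcf]
    simp only [hφa]
    push_cast
    rw [Finset.mul_sum]
    refine Finset.sum_congr rfl fun i _ => ?_
    have := congrArg (algebraMap K Ω) (ht0 i)
    rw [← IsScalarTower.algebraMap_apply] at this
    rw [this, Algebra.smul_def (b : C) (cf i), map_mul, ← IsScalarTower.algebraMap_apply, mul_assoc]
    simp [X', Algebra.smul_def]
  have hθ0K : IsAlgebraic K ((θ0 : L) : Ω) :=
    ((Algebra.IsAlgebraic.of_finite K L).isAlgebraic (θ0 : L)).algHom L.val
  have hθ0C : IsAlgebraic C ((θ0 : L) : Ω) := (IsFractionRing.isAlgebraic_iff C K Ω).mpr hθ0K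
  have hθ1C : IsAlgebraic C (algebraMap C Ω b * ((θ0 : L) : Ω)) :=
    (isAlgebraic_algebraMap _).mul hθ0C
  obtain ⟨d, hd0, hd⟩ := hθ1C.exists_integral_multiple
  set θ : Ω := d • (algebraMap C Ω b * ((θ0 : L) : Ω)) with hθ
  have hsum : ∑ i, φ (d * t0 i) * X i = θ := by
    rw [hθ, ← hθ1, Algebra.smul_def, Finset.mul_sum]
    refine Finset.sum_congr rfl fun i _ => ?_
    rw [map_mul, ← hφa, mul_assoc]
  have hdvd : ∀ G : C[X], G.eval₂ φ θ = 0 ↔ minpoly C θ ∣ G := fun G =>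
    minpoly.isIntegrallyClosed_dvd_iff hd G
  -- express `X i` as polynomials in `θ`
  have hpoly : ∀ i, ∃ g : K[X], aeval θ g = X i := by
    intro i
    have h1 := hprim i
    rw [← IntermediateField.mem_toSubalgebra,
      IntermediateField.adjoin_simple_toSubalgebra_of_isAlgebraic
        ((Algebra.IsAlgebraic.of_finite K L).isAlgebraic (θ0 : L)),
      Algebra.adjoin_singleton_eq_range_aeval] at h1
    obtain ⟨g, hg⟩ := h1
    have h2 : aeval ((θ0 : L) : Ω) g = X i := by
      have := congrArg L.val hg
      change L.val (aeval (θ0 : L) g) = X i at this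
      rw [← Polynomial.aeval_algHom_apply] at this
      exact this
    refine ⟨g.comp (Polynomial.C (algebraMap C K (d * b))⁻¹ * Polynomial.X), ?_⟩
    rw [aeval_comp, ← h2]
    congr 2
    have hne : algebraMap C Ω (d * b) ≠ 0 := by
      rw [← hφa, Ne, map_eq_zero_iff φ hφ]; exact mul_ne_zero hd0 hb0
    simp only [map_mul, aeval_C, aeval_X, map_inv₀, ← IsScalarTower.algebraMap_apply]
    rw [hθ, Algebra.smul_def, ← mul_assoc (algebraMap C Ω d), ← map_mul]
    exact inv_mul_cancel_left₀ hne _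
  choose g hg using hpoly
  have hcl : ∀ i, ∃ (e : C) (N : C[X]), e ≠ 0 ∧ φ e * X i = N.eval₂ φ θ := by
    intro i
    obtain ⟨e, he2, he⟩ := IsLocalization.integerNormalization_spec (nonZeroDivisors C) (g i)
    refine ⟨e, IsLocalization.integerNormalization (nonZeroDivisors C) (g i),
      nonZeroDivisors.ne_zero he2, ?_⟩
    have := congrArg (aeval θ) he
    rw [aeval_map_algebraMap] at this
    change _ = aeval θ _
    rw [this, ← hg i, hφa, ← IsScalarTower.algebraMap_smul K e (g i), map_smul, Algebra.smul_def,
      ← IsScalarTower.algebraMap_apply]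
  choose e N0 he0 hN0 using hcl
  refine ⟨minpoly C θ, ∏ i, e i, fun i => Polynomial.C (∏ j ∈ Finset.univ.erase i, e j) * N0 i,
    fun i => d * t0 i, minpoly.monic hd, Finset.prod_ne_zero_iff.mpr fun i _ => he0 i, ?_, ?_, ?_⟩
  · rw [hsum, Ne, hdvd]
    intro hdv
    have hpos := minpoly.natDegree_pos hd
    have hd' : (minpoly C θ).derivative ≠ 0 := fun h0 =>
      hpos.ne' (derivative_eq_zero.mp h0)
    exact (minpoly.monic hd).not_dvd_of_natDegree_lt hd' (natDegree_derivative_lt hpos.ne') hdv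
  · intro i
    rw [hsum, eval₂_mul, eval₂_C, ← hN0 i, ← Finset.prod_erase_mul _ _ (Finset.mem_univ i), map_mul,
      mul_assoc]
  · intro G
    rw [hsum]
    exact hdvd G


/-- The quadratic form associated with a matrix. -/
noncomputable def qf {n : ℕ} (A : Matrix (Fin n) (Fin n) ℝ) (v : Fin n → ℝ) : ℝ :=
  ∑ j, ∑ l, A j l * v j * v l

lemma qf_smul {n : ℕ} (A : Matrix (Fin n) (Fin n) ℝ) (s : ℝ) (v : Fin n → ℝ) :
    qf A (fun i => s * v i) = s ^ 2 * qf A v := by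
  unfold qf
  simp only [Finset.mul_sum]
  refine Finset.sum_congr rfl fun i _ => Finset.sum_congr rfl fun j _ => ?_
  ring

/-- The quadratic form as a polynomial. -/
noncomputable def qpoly {n : ℕ} (A : Matrix (Fin n) (Fin n) ℝ) : MvPolynomial (Fin n) ℝ :=
  ∑ j, ∑ l, MvPolynomial.C (A j l) * MvPolynomial.X j * MvPolynomial.X l

lemma eval_qpoly {n : ℕ} (A : Matrix (Fin n) (Fin n) ℝ) (v : Fin n → ℝ) :
    MvPolynomial.eval v (qpoly A) = qf A v := by
  simp [qpoly, qf]

lemma qpoly_alg {n : ℕ} (Q : Fin n → Matrix (Fin n) (Fin n) ℝ)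
    (hsym : ∀ i j l, Q i j l = Q i l j)
    (hdet : (Matrix.of fun i j => ∑ l, Q i j l).det ≠ 0) :
    AlgebraicIndependent ℝ (fun i => algebraMap (MvPolynomial (Fin n) ℝ)
        (FractionRing (MvPolynomial (Fin n) ℝ)) (qpoly (Q i))) ∧
    ∀ y : FractionRing (MvPolynomial (Fin n) ℝ), IsAlgebraic (Algebra.adjoin ℝ (Set.range (fun i => algebraMap (MvPolynomial (Fin n) ℝ)
        (FractionRing (MvPolynomial (Fin n) ℝ)) (qpoly (Q i))))) y := by
  let S := MvPolynomial (Fin n) ℝ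
  let Ω := FractionRing S
  let F : Fin n → Ω := fun i => algebraMap S Ω (qpoly (Q i))
  let K := IntermediateField.adjoin ℝ (Set.range F)
  let x : Fin n → Ω := fun j => algebraMap S Ω (MvPolynomial.X j)
  have hC : ∀ r : ℝ, algebraMap S Ω (MvPolynomial.C r) = algebraMap ℝ Ω r := by
    intro r
    rw [IsScalarTower.algebraMap_apply ℝ S Ω]
    rfl
  have hx : ∀ j, IsAlgebraic K (x j) := by
    refine alg_of_jac K (fun i j l => algebraMap ℝ Ω (Q i j l))
      (fun i j l => K.algebraMap_mem _) (fun i j l => by rw [hsym]) x ?_ ?_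
    · intro i
      have : ∑ j, ∑ l, algebraMap ℝ Ω (Q i j l) * x j * x l = F i := by
        simp only [F, qpoly, map_sum, map_mul, hC, x]
      rw [this]
      exact IntermediateField.subset_adjoin _ _ ⟨i, rfl⟩
    · have h1 : (Matrix.of fun i j => ∑ l, algebraMap ℝ Ω (Q i j l) * x l)
          = (algebraMap S Ω).mapMatrix
            (Matrix.of fun i j => ∑ l, MvPolynomial.C (Q i j l) * MvPolynomial.X l) := by
        ext i j
        simp [hC, x]
      rw [h1, ← RingHom.map_det, Ne, map_eq_zero_iff _ (IsFractionRing.injective S Ω)]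
      intro h0
      apply hdet
      have h2 := congrArg (MvPolynomial.eval (fun _ : Fin n => (1 : ℝ))) h0
      rw [RingHom.map_det, map_zero] at h2
      rw [← h2]
      congr 1
      ext i j
      simp
  have hS : ∀ p : S, algebraMap S Ω p ∈ algebraicClosure K Ω := by
    intro p
    induction p using MvPolynomial.induction_on with
    | C a =>
      rw [hC, IsScalarTower.algebraMap_apply ℝ K Ω]
      exact IntermediateField.algebraMap_mem _ _
    | add p q hp hq => rw [map_add]; exact add_mem hp hq
    | mul_X p i hp => rw [map_mul]; exact mul_mem hp (mem_algebraicClosure_iff.mpr (hx i))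
  have hall : ∀ y : Ω, IsAlgebraic (Algebra.adjoin ℝ (Set.range F)) y := by
    intro y
    obtain ⟨p, q, -, rfl⟩ := IsFractionRing.div_surjective (A := S) y
    exact IntermediateField.isAlgebraic_adjoin_iff.mp
      (mem_algebraicClosure_iff.mp (div_mem (hS p) (hS q)))
  refine ⟨?_, hall⟩
  have : Algebra.IsAlgebraic (Algebra.adjoin ℝ (Set.range F)) Ω := ⟨hall⟩
  have hxi : AlgebraicIndependent ℝ x :=
    (MvPolynomial.algebraicIndependent_X (Fin n) ℝ).map'
      (f := IsScalarTower.toAlgHom ℝ S Ω) (IsFractionRing.injective S Ω)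
  exact (Algebra.IsAlgebraic.isTranscendenceBasis_of_le_trdeg_of_finite ℝ F
    hxi.cardinalMk_le_trdeg).1

open Polynomial in
lemma part_b_core {n : ℕ} (hn : 2 ≤ n) (Q : Fin n → Matrix (Fin n) (Fin n) ℝ)
    (hsym : ∀ i j l, Q i j l = Q i l j) (hpos : ∀ i v, 0 ≤ qf (Q i) v)
    (hdet : (Matrix.of fun i j => ∑ l, Q i j l).det ≠ 0) :
    volume {z : Fin n → ℝ | ∀ w, (∀ i, qf (Q i) w = qf (Q i) z) → w = z ∨ w = -z} = 0 := by
  let S := MvPolynomial (Fin n) ℝ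
  let Ω := FractionRing S
  obtain ⟨hF, hall⟩ := qpoly_alg Q hsym hdet
  let φ0 : S →ₐ[ℝ] S := MvPolynomial.aeval (fun i => qpoly (Q i))
  have hφX : ∀ i, φ0 (MvPolynomial.X i) = qpoly (Q i) := fun i => MvPolynomial.aeval_X _ _
  have hφC : ∀ r, φ0 (MvPolynomial.C r) = MvPolynomial.C r := fun r => φ0.commutes r
  let ι : S →+* Ω := algebraMap S Ω
  have hι : Function.Injective ι := IsFractionRing.injective S Ω
  let φ : S →+* Ω := ι.comp φ0.toRingHom
  have hφF : ∀ p, φ p = MvPolynomial.aeval (fun i => ι (qpoly (Q i))) p := by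
    intro p
    change (IsScalarTower.toAlgHom ℝ S Ω) (φ0 p) = _
    rw [← AlgHom.comp_apply, MvPolynomial.comp_aeval]
    rfl
  have hφ : Function.Injective φ := by
    intro p q h
    rw [hφF, hφF] at h
    exact hF h
  have hφ0 : Function.Injective φ0 := fun p q h => hφ (congrArg ι h)
  let X2 : Fin n × Fin n → S := fun p => MvPolynomial.X p.1 * MvPolynomial.X p.2
  have halg : ∀ i, ∃ p : S[X], p ≠ 0 ∧ p.eval₂ φ (ι (X2 i)) = 0 := by
    intro i
    obtain ⟨p, hp0, hp⟩ := hall (ι (X2 i))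
    refine ⟨p.map (hF.aevalEquiv.symm : _ →+* S), ?_, ?_⟩
    · rwa [Ne, Polynomial.map_eq_zero_iff (by exact hF.aevalEquiv.symm.injective)]
    · rw [eval₂_map]
      rw [← hp, aeval_def]
      congr 1
      ext y
      change φ (hF.aevalEquiv.symm y) = (y : Ω)
      rw [hφF]
      exact congrArg Subtype.val (hF.aevalEquiv.apply_symm_apply y)
  obtain ⟨m, D, N, t, hm, hD, hder, hN, hdvd⟩ := prim_elt φ hφ (fun i => ι (X2 i)) halg
  let θ : S := ∑ i, φ0 (t i) * X2 i
  have hθ : ∑ i, φ (t i) * ι (X2 i) = ι θ := by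
    simp [θ, φ]
  rw [hθ] at hder
  simp only [hθ] at hN hdvd
  have hev0 : ∀ G : S[X], G.eval₂ φ (ι θ) = ι (G.eval₂ φ0.toRingHom θ) := by
    intro G
    rw [hom_eval₂]
  have hdvd0 : ∀ G : S[X], G.eval₂ φ0.toRingHom θ = 0 ↔ m ∣ G := by
    intro G
    rw [← hdvd, hev0, map_eq_zero_iff ι hι]
  have hN0 : ∀ i, (N i).eval₂ φ0.toRingHom θ = φ0 D * X2 i := by
    intro i
    apply hι
    rw [← hev0, ← hN]
    exact (map_mul ι _ _).symm
  have hder0 : m.derivative.eval₂ φ0.toRingHom θ ≠ 0 := by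
    intro h
    apply hder
    rw [hev0, h, map_zero]
  -- evaluation
  have hφz : ∀ (z : Fin n → ℝ) (p : S), MvPolynomial.eval z (φ0 p)
      = MvPolynomial.eval (fun i => qf (Q i) z) p := by
    intro z p
    have : (MvPolynomial.eval z).comp φ0.toRingHom = MvPolynomial.eval (fun i => qf (Q i) z) := by
      ext p
      · simp
      · change MvPolynomial.eval z (φ0 (MvPolynomial.X p)) = _
        rw [hφX, eval_qpoly, MvPolynomial.eval_X]
    exact RingHom.congr_fun this p
  have hevz : ∀ (z : Fin n → ℝ) (G : S[X]), MvPolynomial.eval z (G.eval₂ φ0.toRingHom θ)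
      = (G.map (MvPolynomial.eval (fun i => qf (Q i) z))).eval (MvPolynomial.eval z θ) := by
    intro z G
    rw [hom_eval₂, eval_map]
    congr 1
    exact RingHom.ext (hφz z)
  let i0 : Fin n := ⟨0, by omega⟩
  let i1 : Fin n := ⟨1, by omega⟩
  have key : ∀ (c : Fin n → ℝ) (τ : ℝ), MvPolynomial.eval c D ≠ 0 → c i0 ≠ 0 →
      (m.map (MvPolynomial.eval c)).eval τ = 0 →
      ∃ (s : ℝ) (v : Fin n → ℝ), s ≠ 0 ∧ (∀ i, c i = s * qf (Q i) v) ∧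
        τ = ∑ i, MvPolynomial.eval c (t i) * (s * v i.1 * v i.2) := by
    intro c τ hDc hc0 hτ
    let ev : S[X] →+* ℝ := (evalRingHom τ).comp (mapRingHom (MvPolynomial.eval c))
    have hevC : ∀ a : S, ev (C a) = MvPolynomial.eval c a := by intro a; simp [ev]
    have hevX : ev X = τ := by simp [ev]
    have hzero : ∀ G : S[X], G.eval₂ φ0.toRingHom θ = 0 → ev G = 0 := by
      intro G hG
      obtain ⟨H, rfl⟩ := (hdvd0 G).mp hG
      rw [map_mul]
      have : ev m = 0 := hτ
      rw [this, zero_mul]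
    set d := MvPolynomial.eval c D with hd
    let Y : Fin n → Fin n → ℝ := fun i j => ev (N (i, j)) / d
    have hYN : ∀ i j, ev (N (i, j)) = d * Y i j := by
      intro i j
      simp only [Y]
      field_simp
    have hYs : ∀ i j, Y i j = Y j i := by
      intro i j
      have := hzero (N (i, j) - N (j, i)) (by
        rw [eval₂_sub, hN0, hN0]
        simp only [X2]
        ring)
      rw [map_sub, hYN, hYN, ← mul_sub] at this
      exact sub_eq_zero.mp ((mul_eq_zero.mp this).resolve_left hDc)
    have hYr : ∀ i j k l, Y i j * Y k l = Y i l * Y k j := by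
      intro i j k l
      have := hzero (N (i, j) * N (k, l) - N (i, l) * N (k, j)) (by
        rw [eval₂_sub, eval₂_mul, eval₂_mul, hN0, hN0, hN0, hN0]
        simp only [X2]
        ring)
      rw [map_sub, map_mul, map_mul, hYN, hYN, hYN, hYN] at this
      have h2 : d ^ 2 * (Y i j * Y k l - Y i l * Y k j) = 0 := by rw [← this]; ring
      exact sub_eq_zero.mp ((mul_eq_zero.mp h2).resolve_left (pow_ne_zero 2 hDc))
    have hYc : ∀ i, c i = ∑ j, ∑ l, Q i j l * Y j l := by
      intro i
      have := hzero (∑ j, ∑ l, C (MvPolynomial.C (Q i j l)) * N (j, l) -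
          C D * C (MvPolynomial.X i)) (by
        rw [eval₂_sub, eval₂_finsetSum, eval₂_mul, eval₂_C, eval₂_C]
        simp only [eval₂_finsetSum, eval₂_mul, eval₂_C, hN0]
        have e1 : φ0.toRingHom D = φ0 D := rfl
        have e2 : φ0.toRingHom (MvPolynomial.X i) = qpoly (Q i) := hφX i
        have e3 : ∀ r, φ0.toRingHom (MvPolynomial.C r) = MvPolynomial.C r := hφC
        rw [e1, e2, qpoly, Finset.mul_sum, sub_eq_zero]
        refine Finset.sum_congr rfl fun j _ => ?_
        rw [Finset.mul_sum]
        refine Finset.sum_congr rfl fun l _ => ?_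
        rw [e3]
        simp only [X2]
        ring)
      simp only [map_sub, map_sum, map_mul, hevC, hYN, MvPolynomial.eval_C, MvPolynomial.eval_X]
        at this
      have h2 : d * (∑ j, ∑ l, Q i j l * Y j l - c i) = 0 := by
        rw [← this, mul_sub, Finset.mul_sum]
        congr 1
        refine Finset.sum_congr rfl fun j _ => ?_
        rw [Finset.mul_sum]
        refine Finset.sum_congr rfl fun l _ => ?_
        ring
      exact (sub_eq_zero.mp ((mul_eq_zero.mp h2).resolve_left hDc)).symm
    have hYτ : τ = ∑ i, MvPolynomial.eval c (t i) * Y i.1 i.2 := by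
      have := hzero (∑ i, C (t i) * N i - C D * X) (by
        rw [eval₂_sub, eval₂_finsetSum, eval₂_mul, eval₂_C, eval₂_X]
        simp only [eval₂_mul, eval₂_C, hN0]
        rw [sub_eq_zero]
        rw [show θ = ∑ i, φ0 (t i) * X2 i from rfl]
        rw [Finset.mul_sum]
        refine Finset.sum_congr rfl fun i _ => ?_
        change φ0 (t i) * _ = φ0 D * _
        ring)
      simp only [map_sub, map_sum, map_mul, hevC, hevX] at this
      have h2 : d * (∑ i, MvPolynomial.eval c (t i) * Y i.1 i.2 - τ) = 0 := by
        rw [← this, mul_sub, Finset.mul_sum]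
        congr 1
        refine Finset.sum_congr rfl fun i _ => ?_
        rw [show N i = N (i.1, i.2) from rfl, hYN]
        ring
      exact (sub_eq_zero.mp ((mul_eq_zero.mp h2).resolve_left hDc)).symm
    obtain ⟨s, v, hs, hv⟩ := rank_one Y hYs hYr (by
      by_contra hcon
      push Not at hcon
      apply hc0
      rw [hYc]
      simp [hcon])
    refine ⟨s, v, hs, fun i => ?_, ?_⟩
    · rw [hYc, qf, Finset.mul_sum]
      refine Finset.sum_congr rfl fun j _ => ?_
      rw [Finset.mul_sum]
      refine Finset.sum_congr rfl fun l _ => ?_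
      rw [hv]; ring
    · rw [hYτ]
      refine Finset.sum_congr rfl fun i _ => ?_
      rw [hv]
  -- the degree is even
  have heven : Even m.natDegree := by
    by_contra hodd
    rw [Nat.not_even_iff_odd] at hodd
    have hex : ∃ c : Fin n → ℝ, c i0 < 0 ∧ 0 < c i1 ∧ MvPolynomial.eval c D ≠ 0 := by
      by_contra hcon
      push Not at hcon
      apply hD
      apply MvPolynomial.funext_set (fun i => if i = i0 then Set.Iio (0 : ℝ) else Set.Ioi 0)
      · intro i
        split_ifs
        · exact Set.Iio_infinite 0
        · exact Set.Ioi_infinite 0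
      · intro c hc
        rw [map_zero]
        apply hcon
        · have := hc i0 (Set.mem_univ _)
          simpa using this
        · have := hc i1 (Set.mem_univ _)
          simpa [i0, i1] using this
    obtain ⟨c, hc0, hc1, hDc⟩ := hex
    obtain ⟨τ, hτ⟩ := odd_root (m.map (MvPolynomial.eval c)) (hm.map _)
      (by rwa [hm.natDegree_map])
    obtain ⟨s, v, hs, hv, -⟩ := key c τ hDc hc0.ne hτ
    rw [hv] at hc0 hc1
    have h0 := hpos i0 v
    have h1 := hpos i1 v
    rcases lt_or_gt_of_ne hs with h | h
    · nlinarith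
    · nlinarith
  -- the generic locus
  have hq0 : qpoly (Q i0) ≠ 0 := by
    intro h0
    have : φ0 (MvPolynomial.X i0) = φ0 0 := by rw [hφX, h0, map_zero]
    exact MvPolynomial.X_ne_zero _ (hφ0 this)
  have hφD : φ0 D ≠ 0 := by
    intro h0
    exact hD (hφ0 (by rw [h0, map_zero]))
  have hnull := null_zeros n (qpoly (Q i0) * φ0 D * m.derivative.eval₂ φ0.toRingHom θ)
    (mul_ne_zero (mul_ne_zero hq0 hφD) hder0)
  refine measure_mono_null ?_ hnull
  intro z hz
  by_contra hcon
  rw [Set.mem_ofPred_eq, map_mul, map_mul] at hcon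
  have hcon1 := left_ne_zero_of_mul (left_ne_zero_of_mul hcon)
  have hcon2 := right_ne_zero_of_mul (left_ne_zero_of_mul hcon)
  have hcon3 := right_ne_zero_of_mul hcon
  rw [eval_qpoly] at hcon1
  rw [hφz] at hcon2
  rw [hevz, ← derivative_map] at hcon3
  set c : Fin n → ℝ := fun i => qf (Q i) z with hc
  have hroot : (m.map (MvPolynomial.eval c)).eval (MvPolynomial.eval z θ) = 0 := by
    rw [← hevz, (hdvd0 m).mpr dvd_rfl, map_zero]
  obtain ⟨τ, hτ, hτne⟩ := even_root _ (hm.map _) (by rwa [hm.natDegree_map]) _ hroot hcon3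
  obtain ⟨s, v, hs, hv, hτv⟩ := key c τ hcon2 hcon1 hτ
  have hspos : 0 < s := by
    have h0 := hpos i0 v
    have h1 : 0 < c i0 := lt_of_le_of_ne (hpos i0 z) (Ne.symm hcon1)
    rw [hv] at h1
    rcases lt_or_gt_of_ne hs with h | h
    · nlinarith
    · exact h
  have hsq : Real.sqrt s ^ 2 = s := Real.sq_sqrt hspos.le
  have hw := hz (fun i => Real.sqrt s * v i) (fun i => by
    rw [qf_smul, hsq, ← hv])
  apply hτne
  rw [hτv]
  have hθz : MvPolynomial.eval z θ = ∑ i, MvPolynomial.eval c (t i) * (z i.1 * z i.2) := by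
    simp only [θ, map_sum, map_mul, hφz, X2, MvPolynomial.eval_X]
    rfl
  rw [hθz]
  refine Finset.sum_congr rfl fun i _ => ?_
  congr 1
  have hsv : s * v i.1 * v i.2 = (Real.sqrt s * v i.1) * (Real.sqrt s * v i.2) := by
    nth_rewrite 1 [← hsq]; ring
  rw [hsv]
  rcases hw with hw | hw
  · rw [← hw]
  · have e1 := congrFun hw i.1
    have e2 := congrFun hw i.2
    simp only [Pi.neg_apply] at e1 e2
    rw [e1, e2]; ring


lemma qf_gram {n r : ℕ} (P : Matrix (Fin r) (Fin n) ℝ) (v : Fin n → ℝ) :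
    qf (fun j l => ∑ a, P a j * P a l) v = (P.mulVec v) ⬝ᵥ (P.mulVec v) := by
  simp only [qf, dotProduct, Matrix.mulVec, Finset.sum_mul, Finset.mul_sum]
  rw [Finset.sum_comm' (t' := Finset.univ) (s' := fun _ => Finset.univ) (by simp)]
  rw [Finset.sum_comm]
  simp only [Finset.sum_comm (γ := Fin r)]
  rw [Finset.sum_comm]
  refine Finset.sum_congr rfl fun a _ => ?_
  refine Finset.sum_congr rfl fun j _ => ?_
  refine Finset.sum_congr rfl fun l _ => ?_
  ring

lemma part_b (n k : ℕ) (hn : 2 ≤ n) (r : Fin k → ℕ) (hr : ∀ i, 1 ≤ r i) (hkn : k ≤ n) :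
      ∃ q : MvPolynomial (Σ i : Fin k, Fin (r i) × Fin n) ℝ, q ≠ 0 ∧
        ∀ P : ∀ i : Fin k, Matrix (Fin (r i)) (Fin n) ℝ,
          MvPolynomial.eval (fun v => P v.1 v.2.1 v.2.2) q ≠ 0 →
          volume {z : Fin n → ℝ | IdUpToSign P z} = 0 := by
  let Qp : Fin n → Fin n → Fin n → MvPolynomial (Σ i : Fin k, Fin (r i) × Fin n) ℝ :=
    fun i j l => if h : (i : ℕ) < k then
      ∑ a, MvPolynomial.X ⟨⟨i, h⟩, a, j⟩ * MvPolynomial.X ⟨⟨i, h⟩, a, l⟩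
      else if j = i ∧ l = i then 1 else 0
  let Q : (∀ i : Fin k, Matrix (Fin (r i)) (Fin n) ℝ) → Fin n → Matrix (Fin n) (Fin n) ℝ :=
    fun P i j l => if h : (i : ℕ) < k then ∑ a, P ⟨i, h⟩ a j * P ⟨i, h⟩ a l
      else if j = i ∧ l = i then 1 else 0
  have hQ : ∀ P i j l, MvPolynomial.eval (fun v => P v.1 v.2.1 v.2.2) (Qp i j l) = Q P i j l := by
    intro P i j l
    simp only [Qp, Q]
    split_ifs with h1 h2
    · simp
    · simp [h2]
    · simp [h2]
  have hdetQ : ∀ P, MvPolynomial.eval (fun v => P v.1 v.2.1 v.2.2)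
      (Matrix.of fun i j => ∑ l, Qp i j l).det = (Matrix.of fun i j => ∑ l, Q P i j l).det := by
    intro P
    rw [RingHom.map_det]
    congr 1
    ext i j
    simp [hQ]
  refine ⟨(Matrix.of fun i j => ∑ l, Qp i j l).det, ?_, ?_⟩
  · intro h0
    let P0 : ∀ i : Fin k, Matrix (Fin (r i)) (Fin n) ℝ :=
      fun i a j => if (a : ℕ) = 0 ∧ (j : ℕ) = i then 1 else 0
    have h1 := hdetQ P0
    rw [h0, map_zero] at h1
    have h2 : (Matrix.of fun i j => ∑ l, Q P0 i j l) = (1 : Matrix (Fin n) (Fin n) ℝ) := by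
      have h3 : ∀ i j l, Q P0 i j l = if j = i ∧ l = i then 1 else 0 := by
        intro i j l
        simp only [Q]
        split_ifs with ha hb hb
        · obtain ⟨rfl, rfl⟩ := hb
          rw [Finset.sum_eq_single ⟨0, hr _⟩]
          · simp [P0]
          · intro b _ hb
            have : (b : ℕ) ≠ 0 := fun h => hb (Fin.ext h)
            simp [P0, this]
          · simp
        · apply Finset.sum_eq_zero
          intro a _
          simp only [P0]
          by_contra hne
          apply hb
          constructor
          · by_contra hji
            exact hne (by rw [if_neg (fun h => hji (Fin.ext h.2)), zero_mul])
          · by_contra hji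
            exact hne (by rw [if_neg (c := (a : ℕ) = 0 ∧ (l : ℕ) = _)
              (fun h => hji (Fin.ext h.2)), mul_zero])
        · simp [hb]
        · simp [hb]
      ext i j
      simp only [Matrix.of_apply, h3, Matrix.one_apply]
      by_cases hij : i = j
      · subst hij; simp
      · have : j ≠ i := fun h => hij h.symm
        simp [hij, this]
    rw [h2, Matrix.det_one] at h1
    exact zero_ne_one h1
  · intro P hP
    rw [hdetQ] at hP
    have hcore := part_b_core hn (Q P) ?_ ?_ hP
    · refine measure_mono_null ?_ hcore
      intro z hz w hw
      apply hz w
      intro i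
      have h1 := hw ⟨i, by omega⟩
      have h2 : Q P ⟨i, by omega⟩ = fun j l => ∑ a, P i a j * P i a l := by
        funext j l
        simp [Q]
      rw [h2, qf_gram, qf_gram] at h1
      exact h1
    · intro i j l
      simp only [Q]
      by_cases h : (i : ℕ) < k
      · simp only [h, dite_true]
        exact Finset.sum_congr rfl fun a _ => mul_comm _ _
      · simp only [h, dite_false, and_comm]
    · intro i v
      by_cases h : (i : ℕ) < k
      · have h2 : Q P i = fun j l => ∑ a, P ⟨i, h⟩ a j * P ⟨i, h⟩ a l := by
          funext j l
          simp [Q, h]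
        rw [h2, qf_gram]
        exact Finset.sum_nonneg fun a _ => mul_self_nonneg _
      · have h2 : Q P i = fun j l => if j = i ∧ l = i then 1 else 0 := by
          funext j l
          simp [Q, h]
        have h3 : qf (Q P i) v = v i * v i := by
          rw [h2]
          unfold qf
          rw [Finset.sum_eq_single i, Finset.sum_eq_single i]
          · simp
          · intro b _ hb; simp [hb]
          · simp
          · intro b _ hb; simp [hb]
          · simp
        rw [h3]
        exact mul_self_nonneg _


lemma gram_special {n k : ℕ} (r : Fin k → ℕ) (hr : ∀ i, 1 ≤ r i) (i : Fin k) (j l : Fin n) :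
    (∑ a : Fin (r i), (if (a : ℕ) = 0 ∧ (j : ℕ) = i then (1 : ℝ) else 0) *
      (if (a : ℕ) = 0 ∧ (l : ℕ) = i then (1 : ℝ) else 0)) =
      if (j : ℕ) = i ∧ (l : ℕ) = i then 1 else 0 := by
  rw [Finset.sum_eq_single ⟨0, hr _⟩]
  · by_cases h1 : (j : ℕ) = i <;> by_cases h2 : (l : ℕ) = i <;> simp [h1, h2]
  · intro b _ hb
    have : (b : ℕ) ≠ 0 := fun h => hb (Fin.ext h)
    simp [this]
  · simp

lemma sq_gram {Ω : Type} [Field Ω] {n r : ℕ} (p : Fin r → Fin n → Ω) (w : Fin n → Ω) :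
    ∑ a, (∑ j, p a j * w j) ^ 2 = ∑ j, ∑ l, (∑ a, p a j * p a l) * w j * w l := by
  simp only [Finset.sum_mul]
  have h1 : ∀ j, ∑ l, ∑ a, p a j * p a l * w j * w l = ∑ a, ∑ l, p a j * p a l * w j * w l :=
    fun j => Finset.sum_comm
  simp only [h1]
  rw [Finset.sum_comm]
  refine Finset.sum_congr rfl fun a _ => ?_
  rw [sq, Finset.sum_mul_sum]
  refine Finset.sum_congr rfl fun j _ => ?_
  refine Finset.sum_congr rfl fun l _ => ?_
  ring

lemma jac_ne_zero {n k : ℕ} (hk : n ≤ k) (r : Fin k → ℕ) (hr : ∀ i, 1 ≤ r i)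
    {Ω : Type} [Field Ω] [Algebra ℝ Ω]
    (p : ∀ i : Fin k, Fin (r i) → Fin n → Ω) (x : Fin n → Ω)
    (hu : AlgebraicIndependent ℝ
      (Sum.elim (fun v : Σ i : Fin k, Fin (r i) × Fin n => p v.1 v.2.1 v.2.2) x)) :
    (Matrix.of fun i j : Fin n => ∑ l, (∑ a, p (Fin.castLE hk i) a j * p (Fin.castLE hk i) a l)
      * x l).det ≠ 0 := by
  let q : Matrix (Fin n) (Fin n) (MvPolynomial ((Σ i : Fin k, Fin (r i) × Fin n) ⊕ Fin n) ℝ) :=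
    Matrix.of fun i j : Fin n => ∑ l, (∑ a, MvPolynomial.X (Sum.inl ⟨Fin.castLE hk i, a, j⟩) *
      MvPolynomial.X (Sum.inl ⟨Fin.castLE hk i, a, l⟩)) * MvPolynomial.X (Sum.inr l)
  have h1 : (MvPolynomial.aeval (R := ℝ)
      (Sum.elim (fun v : Σ i : Fin k, Fin (r i) × Fin n => p v.1 v.2.1 v.2.2) x)).toRingHom q.det
      = (Matrix.of fun i j : Fin n =>
        ∑ l, (∑ a, p (Fin.castLE hk i) a j * p (Fin.castLE hk i) a l) * x l).det := by
    rw [RingHom.map_det]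
    congr 1
    ext i j
    simp [q]
  rw [← h1]
  intro h0
  have h2 : q.det = 0 := hu (by rw [map_zero]; exact h0)
  have h3 := congrArg (MvPolynomial.eval (Sum.elim
    (fun v : Σ i : Fin k, Fin (r i) × Fin n =>
      if (v.2.1 : ℕ) = 0 ∧ (v.2.2 : ℕ) = v.1 then (1 : ℝ) else 0) (fun _ => 1))) h2
  rw [RingHom.map_det, map_zero] at h3
  have h4 : (MvPolynomial.eval (Sum.elim
    (fun v : Σ i : Fin k, Fin (r i) × Fin n =>
      if (v.2.1 : ℕ) = 0 ∧ (v.2.2 : ℕ) = v.1 then (1 : ℝ) else 0) (fun _ => 1))).mapMatrix q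
      = 1 := by
    ext i j
    simp only [q, RingHom.mapMatrix_apply, Matrix.map_apply, Matrix.of_apply, map_sum, map_mul,
      MvPolynomial.eval_X, Sum.elim_inl, Sum.elim_inr, mul_one]
    simp only [gram_special r hr]
    simp only [Matrix.one_apply, Fin.val_castLE, ← Fin.ext_iff]
    by_cases hij : i = j
    · subst hij; simp
    · have : j ≠ i := fun h => hij h.symm
      simp [hij, this]
  rw [h4, Matrix.det_one] at h3
  exact one_ne_zero h3

lemma products_eq {Ω : Type} [Field Ω] [Algebra ℝ Ω] (C : IntermediateField ℝ Ω) {n r : ℕ}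
    (hr : 1 ≤ r) (p : Fin r → Fin n → Ω)
    (hp : AlgebraicIndependent C (fun v : Fin r × Fin n => p v.1 v.2))
    (x w : Fin n → Ω) (hx : ∀ j, x j ∈ C) (hw : ∀ j, w j ∈ C)
    (h : ∑ a, (∑ j, p a j * w j) ^ 2 = ∑ a, (∑ j, p a j * x j) ^ 2) (a b : Fin n) :
    w a * w b = x a * x b := by
  let P : (Fin n → C) → MvPolynomial (Fin r × Fin n) C := fun y =>
    ∑ a, (∑ j, MvPolynomial.X (a, j) * MvPolynomial.C (y j)) ^ 2
  let x' : Fin n → C := fun j => ⟨x j, hx j⟩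
  let w' : Fin n → C := fun j => ⟨w j, hw j⟩
  have hP : P w' = P x' := by
    apply hp
    simp only [P, map_sum, map_pow, map_mul, MvPolynomial.aeval_X, MvPolynomial.aeval_C]
    exact h
  have hev : ∀ v : Fin n → C, (∑ j, v j * w' j) ^ 2 = (∑ j, v j * x' j) ^ 2 := by
    intro v
    have h1 := congrArg (MvPolynomial.eval
      (fun q : Fin r × Fin n => if (q.1 : ℕ) = 0 then v q.2 else 0)) hP
    have h2 : ∀ y : Fin n → C, MvPolynomial.eval
      (fun q : Fin r × Fin n => if (q.1 : ℕ) = 0 then v q.2 else 0) (P y)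
        = (∑ j, v j * y j) ^ 2 := by
      intro y
      simp only [P, map_sum, map_pow, map_mul, MvPolynomial.eval_X, MvPolynomial.eval_C]
      rw [Finset.sum_eq_single ⟨0, hr⟩]
      · simp
      · intro b _ hb
        have : (b : ℕ) ≠ 0 := fun h => hb (Fin.ext h)
        simp [this]
      · simp
    rw [h2, h2] at h1
    exact h1
  have e1 := hev (Pi.single a 1)
  have e2 := hev (Pi.single b 1)
  have e3 := hev (Pi.single a 1 + Pi.single b 1)
  simp only [Pi.add_apply, add_mul, Finset.sum_add_distrib, Pi.single_apply, ite_mul, one_mul,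
    zero_mul, Finset.sum_ite_eq', Finset.sum_ite_eq, Finset.mem_univ, if_true] at e1 e2 e3
  have e4 : w' a * w' b = x' a * x' b := by
    have : (2 : C) * (w' a * w' b - x' a * x' b) = 0 := by
      linear_combination e3 - e1 - e2
    have h2 : (2 : C) ≠ 0 := by
      have := algebraRat.charZero C
      exact two_ne_zero
    exact sub_eq_zero.mp ((mul_eq_zero.mp this).resolve_left h2)
  exact congrArg Subtype.val e4


lemma mem_field {n k : ℕ} (hk : n + 1 ≤ k) (r : Fin k → ℕ) (hr : ∀ i, 1 ≤ r i)
    {Ω : Type} [Field Ω] [Algebra ℝ Ω] [IsAlgClosed Ω]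
    (p : ∀ i : Fin k, Fin (r i) → Fin n → Ω) (x : Fin n → Ω)
    (hu : IsTranscendenceBasis ℝ
      (Sum.elim (fun v : Σ i : Fin k, Fin (r i) × Fin n => p v.1 v.2.1 v.2.2) x)) (a b : Fin n) :
    x a * x b ∈ IntermediateField.adjoin ℝ (Set.range
      (Sum.elim (fun v : Σ i : Fin k, Fin (r i) × Fin n => p v.1 v.2.1 v.2.2)
        (fun i => ∑ a, (∑ j, p i a j * x j) ^ 2))) := by
  have hk' : n ≤ k := by omega
  set M := IntermediateField.adjoin ℝ (Set.range
      (Sum.elim (fun v : Σ i : Fin k, Fin (r i) × Fin n => p v.1 v.2.1 v.2.2)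
        (fun i => ∑ a, (∑ j, p i a j * x j) ^ 2))) with hM
  have hpM : ∀ i a j, p i a j ∈ M := fun i a j =>
    IntermediateField.subset_adjoin _ _ ⟨Sum.inl ⟨i, a, j⟩, rfl⟩
  have hfM : ∀ i, ∑ a, (∑ j, p i a j * x j) ^ 2 ∈ M := fun i =>
    IntermediateField.subset_adjoin _ _ ⟨Sum.inr i, rfl⟩
  have hjac := jac_ne_zero hk' r hr p x hu.1
  have hxM : ∀ j, IsAlgebraic M (x j) := by
    refine alg_of_jac M (fun i j l => ∑ a, p (Fin.castLE hk' i) a j * p (Fin.castLE hk' i) a l)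
      (fun i j l => sum_mem fun a _ => mul_mem (hpM _ _ _) (hpM _ _ _))
      (fun i j l => Finset.sum_congr rfl fun a _ => mul_comm _ _) x (fun i => ?_) hjac
    rw [← sq_gram]
    exact hfM _
  have hMalg : Algebra.IsAlgebraic M Ω := by
    rw [hu.isAlgebraic_iff]
    rintro (v | j)
    · exact isAlgebraic_algebraMap (⟨p v.1 v.2.1 v.2.2, hpM _ _ _⟩ : M)
    · exact hxM j
  have : CharZero M := algebraRat.charZero M
  have : IsAlgClosure M Ω := ⟨inferInstance, hMalg⟩
  have : Normal M Ω := IsAlgClosure.normal M Ω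
  have : IsGalois M Ω := ⟨⟩
  suffices hfix : ∀ σ : Gal(Ω/M), σ (x a * x b) = x a * x b by
    obtain ⟨y, hy⟩ := (InfiniteGalois.mem_range_algebraMap_iff_fixed (k := M) _).mpr hfix
    rw [← hy]
    exact y.2
  intro σ
  have hσ : ∀ y ∈ M, σ y = y := fun y hy => σ.commutes ⟨y, hy⟩
  let w : Fin n → Ω := fun j => σ (x j)
  let i0 : Fin k := ⟨n, by omega⟩
  let T : Set ((Σ i : Fin k, Fin (r i) × Fin n) ⊕ Fin n) :=
    Set.range (fun v : Fin (r i0) × Fin n => Sum.inl ⟨i0, v⟩)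
  let u := (Sum.elim (fun v : Σ i : Fin k, Fin (r i) × Fin n => p v.1 v.2.1 v.2.2) x)
  let N := IntermediateField.adjoin ℝ (u '' Tᶜ)
  have hpN : ∀ i a j, i ≠ i0 → p i a j ∈ N := by
    intro i a j hi
    refine IntermediateField.subset_adjoin _ _ ⟨Sum.inl ⟨i, a, j⟩, ?_, rfl⟩
    rintro ⟨v, hv⟩
    exact hi (congrArg Sigma.fst (Sum.inl_injective hv)).symm
  have hxN : ∀ j, x j ∈ N := by
    intro j
    refine IntermediateField.subset_adjoin _ _ ⟨Sum.inr j, ?_, rfl⟩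
    rintro ⟨v, hv⟩
    cases hv
  have hi0 : ∀ i : Fin n, Fin.castLE hk' i ≠ i0 := by
    intro i h
    have := congrArg Fin.val h
    have h2 := i.2
    simp only [Fin.val_castLE, i0] at this
    omega
  have hfw : ∀ i, ∑ a, (∑ j, p i a j * w j) ^ 2 = ∑ a, (∑ j, p i a j * x j) ^ 2 := by
    intro i
    rw [← hσ _ (hfM i)]
    simp only [map_sum, map_pow, map_mul, w]
    simp only [hσ _ (hpM _ _ _)]
  have hwN : ∀ j, IsAlgebraic N (w j) := by
    refine alg_of_jac N (fun i j l => ∑ a, p (Fin.castLE hk' i) a j * p (Fin.castLE hk' i) a l)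
      (fun i j l => sum_mem fun a _ => mul_mem (hpN _ _ _ (hi0 i)) (hpN _ _ _ (hi0 i)))
      (fun i j l => Finset.sum_congr rfl fun a _ => mul_comm _ _) w (fun i => ?_) ?_
    · rw [← sq_gram, hfw]
      exact sum_mem fun a _ => pow_mem (sum_mem fun j _ =>
        mul_mem (hpN _ _ _ (hi0 i)) (hxN j)) _
    · intro h0
      apply hjac
      apply σ.injective
      rw [map_zero, ← h0]
      change (σ : Ω →+* Ω) _ = _
      rw [RingHom.map_det]
      congr 1
      ext i j
      simp only [RingHom.mapMatrix_apply, Matrix.map_apply, Matrix.of_apply, w]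
      change σ _ = _
      simp only [map_sum, map_mul, hσ _ (hpM _ _ _)]
  have hindep : AlgebraicIndependent (algebraicClosure N Ω)
      (fun v : Fin (r i0) × Fin n => p i0 v.1 v.2) := by
    have h1 : AlgebraicIndependent (Algebra.adjoin ℝ (u '' Tᶜ)) (fun i : T => u i) :=
      hu.1.adjoin_of_disjoint disjoint_compl_left
    have h2 := (IntermediateField.algebraicIndependent_adjoin_iff.mpr h1).algebraicClosure
    exact h2.comp (fun v : Fin (r i0) × Fin n => (⟨Sum.inl ⟨i0, v⟩, ⟨v, rfl⟩⟩ : T)) (by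
      intro v v' h
      have := Sum.inl_injective (congrArg Subtype.val h)
      simpa using this)
  rw [map_mul]
  exact products_eq ((algebraicClosure N Ω).restrictScalars ℝ) (hr i0) (p i0) hindep x w
    (fun j => (algebraicClosure N Ω).algebraMap_mem ⟨x j, hxN j⟩)
    (fun j => mem_algebraicClosure_iff.mpr (hwN j)) (hfw i0) a b

lemma exists_universal (ι : Type) :
    ∃ (Ω : Type) (_ : Field Ω) (_ : Algebra ℝ Ω) (_ : IsAlgClosed Ω) (u : ι → Ω),
      IsTranscendenceBasis ℝ u := by
  let S := MvPolynomial ι ℝ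
  let L := FractionRing S
  let Ω := AlgebraicClosure L
  have : Algebra.IsAlgebraic S L := IsLocalization.isAlgebraic L (nonZeroDivisors S)
  have : Algebra.IsAlgebraic S Ω := Algebra.IsAlgebraic.trans S L Ω
  have : FaithfulSMul S Ω := by
    rw [faithfulSMul_iff_algebraMap_injective, IsScalarTower.algebraMap_eq S L Ω]
    exact (algebraMap L Ω).injective.comp (IsFractionRing.injective S L)
  exact ⟨Ω, inferInstance, inferInstance, inferInstance, _,
    (IsTranscendenceBasis.mvPolynomial ι ℝ).algebraMap_comp (A := Ω)⟩


lemma eq_or_neg {n : ℕ} (w z : Fin n → ℝ) (h : ∀ a b, w a * w b = z a * z b) :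
    w = z ∨ w = -z := by
  by_cases hz : ∃ c, z c ≠ 0
  · obtain ⟨c, hc⟩ := hz
    have hcc := h c c
    rcases mul_self_eq_mul_self_iff.mp hcc with h1 | h1
    · left
      funext a
      have h2 := h a c
      rw [h1] at h2
      exact mul_right_cancel₀ hc h2
    · right
      funext a
      have h2 := h a c
      rw [h1] at h2
      apply mul_right_cancel₀ hc
      simp only [Pi.neg_apply]
      linarith
  · push Not at hz
    left
    funext a
    have h2 := h a a
    rw [hz a, mul_zero] at h2
    rw [hz a]
    exact mul_self_eq_zero.mp h2

lemma part_a (n k : ℕ) (r : Fin k → ℕ) (hr : ∀ i, 1 ≤ r i) (hk : n + 1 ≤ k) :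
      ∃ q : MvPolynomial (Σ i : Fin k, Fin (r i) × Fin n) ℝ, q ≠ 0 ∧
        ∀ P : ∀ i : Fin k, Matrix (Fin (r i)) (Fin n) ℝ,
          MvPolynomial.eval (fun v => P v.1 v.2.1 v.2.2) q ≠ 0 →
          volume {z : Fin n → ℝ | ¬ IdUpToSign P z} = 0 := by
  obtain ⟨Ω, _, _, _, u, hu⟩ := exists_universal ((Σ i : Fin k, Fin (r i) × Fin n) ⊕ Fin n)
  have hue : u = Sum.elim (fun v : Σ i : Fin k, Fin (r i) × Fin n =>
      u (Sum.inl ⟨v.1, v.2.1, v.2.2⟩)) (fun j => u (Sum.inr j)) := by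
    funext v
    rcases v with v | v <;> rfl
  have hmem := fun a b => (IntermediateField.mem_adjoin_range_iff ℝ _ _).mp
    (mem_field hk r hr (fun i a j => u (Sum.inl ⟨i, a, j⟩)) (fun j => u (Sum.inr j))
      (by rw [← hue]; exact hu) a b)
  choose N D hND using hmem
  let F : MvPolynomial ((Σ i : Fin k, Fin (r i) × Fin n) ⊕ Fin k) ℝ →ₐ[ℝ]
      MvPolynomial ((Σ i : Fin k, Fin (r i) × Fin n) ⊕ Fin n) ℝ :=
    MvPolynomial.aeval (Sum.elim (fun v => MvPolynomial.X (Sum.inl v))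
      (fun i => ∑ a, (∑ j, MvPolynomial.X (Sum.inl ⟨i, a, j⟩) * MvPolynomial.X (Sum.inr j)) ^ 2))
  have hFu : ∀ G, MvPolynomial.aeval u (F G) = MvPolynomial.aeval
      (Sum.elim (fun v : Σ i : Fin k, Fin (r i) × Fin n => u (Sum.inl ⟨v.1, v.2.1, v.2.2⟩))
        (fun i => ∑ a, (∑ j, u (Sum.inl ⟨i, a, j⟩) * u (Sum.inr j)) ^ 2)) G := by
    intro G
    rw [← AlgHom.comp_apply, MvPolynomial.comp_aeval]
    congr 2
    funext v
    rcases v with v | v <;> simp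
  have hD0 : ∀ a b, F (D a b) ≠ 0 := by
    intro a b h0
    have h1 := hND a b
    rw [← hFu (D a b), h0, map_zero, div_zero] at h1
    exact mul_ne_zero (hu.1.ne_zero (Sum.inr a)) (hu.1.ne_zero (Sum.inr b)) h1
  have hid : ∀ a b, F (D a b) * (MvPolynomial.X (Sum.inr a) * MvPolynomial.X (Sum.inr b))
      = F (N a b) := by
    intro a b
    apply hu.1
    have h2 : MvPolynomial.aeval u (F (D a b)) ≠ 0 := by
      intro h
      exact hD0 a b (hu.1 (by rw [h, map_zero]))
    have h1 := hND a b
    rw [← hFu, ← hFu, eq_div_iff h2] at h1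
    simp only [map_mul, MvPolynomial.aeval_X]
    rw [← h1, mul_comm]
  let G := ∏ a, ∏ b, F (D a b)
  have hG : G ≠ 0 := Finset.prod_ne_zero_iff.mpr fun a _ =>
    Finset.prod_ne_zero_iff.mpr fun b _ => hD0 a b
  obtain ⟨c, hc⟩ : ∃ c, MvPolynomial.eval c G ≠ 0 := by
    by_contra hcon
    push Not at hcon
    exact hG (MvPolynomial.funext fun c => by rw [hcon, map_zero])
  let q : MvPolynomial (Σ i : Fin k, Fin (r i) × Fin n) ℝ :=
    MvPolynomial.aeval (Sum.elim MvPolynomial.X (fun j => MvPolynomial.C (c (Sum.inr j)))) G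
  have hq : ∀ P, MvPolynomial.eval P q
      = MvPolynomial.eval (Sum.elim P (fun j => c (Sum.inr j))) G := by
    intro P
    have h1 : (MvPolynomial.aeval (R := ℝ) P).comp (MvPolynomial.aeval (Sum.elim MvPolynomial.X
        (fun j : Fin n => MvPolynomial.C (c (Sum.inr j)))))
        = MvPolynomial.aeval (Sum.elim P (fun j => c (Sum.inr j))) := by
      apply MvPolynomial.algHom_ext
      rintro (v | v) <;> simp
    exact AlgHom.congr_fun h1 G
  refine ⟨q, ?_, ?_⟩
  · intro h0
    apply hc
    have h1 := hq (fun v => c (Sum.inl v))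
    rw [h0, map_zero] at h1
    rw [h1]
    congr 2
    funext v
    rcases v with v | v <;> rfl
  · intro P hP
    rw [hq] at hP
    let p : (Σ i : Fin k, Fin (r i) × Fin n) → ℝ := fun v => P v.1 v.2.1 v.2.2
    let Gz : MvPolynomial (Fin n) ℝ :=
      MvPolynomial.aeval (Sum.elim (fun v => MvPolynomial.C (p v)) MvPolynomial.X) G
    have hGz : ∀ z, MvPolynomial.eval z Gz = MvPolynomial.eval (Sum.elim p z) G := by
      intro z
      have h1 : (MvPolynomial.aeval (R := ℝ) z).comp (MvPolynomial.aeval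
          (Sum.elim (fun v => MvPolynomial.C (p v)) MvPolynomial.X))
          = MvPolynomial.aeval (Sum.elim p z) := by
        apply MvPolynomial.algHom_ext
        rintro (v | v) <;> simp
      exact AlgHom.congr_fun h1 G
    have hGz0 : Gz ≠ 0 := by
      intro h0
      apply hP
      rw [← hGz, h0, map_zero]
    refine measure_mono_null ?_ (null_zeros n Gz hGz0)
    intro z hz
    by_contra hcon
    apply hz
    rw [Set.mem_ofPred_eq, hGz] at hcon
    intro w hw
    have hF : ∀ (y : Fin n → ℝ) H, MvPolynomial.eval (Sum.elim p y) (F H)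
        = MvPolynomial.eval (Sum.elim p (fun i => (P i).mulVec y ⬝ᵥ (P i).mulVec y)) H := by
      intro y H
      have h1 : (MvPolynomial.aeval (R := ℝ) (Sum.elim p y)).comp F = MvPolynomial.aeval
          (Sum.elim p (fun i => (P i).mulVec y ⬝ᵥ (P i).mulVec y)) := by
        apply MvPolynomial.algHom_ext
        rintro (v | v) <;> simp [F, dotProduct, Matrix.mulVec, sq, p]
      exact AlgHom.congr_fun h1 H
    have hFw : ∀ H, MvPolynomial.eval (Sum.elim p w) (F H)
        = MvPolynomial.eval (Sum.elim p z) (F H) := by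
      intro H
      rw [hF, hF]
      simp only [hw]
    apply eq_or_neg
    intro a b
    have hDz : MvPolynomial.eval (Sum.elim p z) (F (D a b)) ≠ 0 := by
      intro h0
      apply hcon
      simp only [G, map_prod]
      exact Finset.prod_eq_zero (Finset.mem_univ a) (Finset.prod_eq_zero (Finset.mem_univ b) h0)
    have h1 := congrArg (MvPolynomial.eval (Sum.elim p w)) (hid a b)
    have h2 := congrArg (MvPolynomial.eval (Sum.elim p z)) (hid a b)
    simp only [map_mul, MvPolynomial.eval_X, Sum.elim_inr, hFw] at h1 h2
    exact mul_left_cancel₀ hDz (h1.trans h2.symm)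


/-- Generic linear measurements `P_i ∈ ℝ^{r_i × n}` identify
generic real signals up to sign if and only if `k ≥ n + 1`:
(a) if `k ≥ n + 1`, for generic tuples (nonvanishing of a nonzero polynomial `q`
in the entries) the non-identifiable signals form a Lebesgue null set;
(b) if `k ≤ n`, for generic tuples the identifiable signals form a Lebesgue null set. -/
theorem stmt_3 (n k : ℕ) (hn : 2 ≤ n) (hk : 1 ≤ k) (r : Fin k → ℕ) (hr : ∀ i, 1 ≤ r i) :
    (n + 1 ≤ k →
      ∃ q : MvPolynomial (Σ i : Fin k, Fin (r i) × Fin n) ℝ, q ≠ 0 ∧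
        ∀ P : ∀ i : Fin k, Matrix (Fin (r i)) (Fin n) ℝ,
          MvPolynomial.eval (fun v => P v.1 v.2.1 v.2.2) q ≠ 0 →
          volume {z : Fin n → ℝ | ¬ IdUpToSign P z} = 0) ∧
    (k ≤ n →
      ∃ q : MvPolynomial (Σ i : Fin k, Fin (r i) × Fin n) ℝ, q ≠ 0 ∧
        ∀ P : ∀ i : Fin k, Matrix (Fin (r i)) (Fin n) ℝ,
          MvPolynomial.eval (fun v => P v.1 v.2.1 v.2.2) q ≠ 0 →
          volume {z : Fin n → ℝ | IdUpToSign P z} = 0) := by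
  exact ⟨part_a n k r hr, part_b n k hn r hr⟩
end

section
/- Let n ≥ 2. There exists a Zariski-closed set E ⊊ (ℂ^{n×n})^n × ℂ^n (a proper Zariski-closed subset of the space of tuples (A_1,…,A_n, z)) such that for every (A_1,…,A_n, z) not in E, the set {w ∈ ℂ^n : w^⊤A_i w = z^⊤A_i z for all i = 1,…,n} has exactly 2^n elements; in particular, for such tuples there exists w ∈ ℂ^n with w ≠ z, w ≠ −z, and w^⊤A_i w = z^⊤A_i z for all i. Consequently, no n measurement matrices suffice for perturbation-stable generic identifiability of complexified real signals, i.e., the generic identifiability threshold is at least n+1. -/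
open Matrix

/-- Coordinates of a tuple `(A_1, …, A_n, z) ∈ (ℂ^{n×n})^n × ℂ^n`. -/
def tupleCoords (n : ℕ) (x : (Fin n → Matrix (Fin n) (Fin n) ℂ) × (Fin n → ℂ)) :
    ((Fin n × Fin n × Fin n) ⊕ Fin n) → ℂ :=
  Sum.elim (fun t => x.1 t.1 t.2.1 t.2.2) x.2

namespace QuadCount

/-- Index set of coordinates. -/
abbrev Idx (n : ℕ) := (Fin n × Fin n × Fin n) ⊕ Fin n

/-- Right-hand side `zᵀ A_i z`. -/
def rhs {n : ℕ} {R : Type*} [CommRing R] (y : Idx n → R) (i : Fin n) : R :=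
  ∑ j, ∑ k, y (Sum.inl (i, j, k)) * (y (Sum.inr j) * y (Sum.inr k))

/-- `w` solves the system with parameter `y`. -/
def IsSol {n : ℕ} {R : Type*} [CommRing R] (y : Idx n → R) (w : Fin n → R) : Prop :=
  ∀ i, ∑ j, ∑ k, y (Sum.inl (i, j, k)) * (w j * w k) = rhs y i

/-- Exponents of degree at most `n + 1`. -/
abbrev Mon (n : ℕ) := {e : Fin n → ℕ // ∑ i, e i ≤ n + 1}

instance (n : ℕ) : Finite (Mon n) := by
  have : Function.Injective (fun (e : Mon n) (i : Fin n) =>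
      (⟨e.1 i, by
        have h1 := e.2
        have h2 := Finset.single_le_sum (f := e.1) (fun i _ => Nat.zero_le _) (Finset.mem_univ i)
        omega⟩ : Fin (n + 2))) := by
    intro a b h
    apply Subtype.ext
    funext i
    have := congrFun h i
    simpa using this
  exact Finite.of_injective _ this

noncomputable instance (n : ℕ) : Fintype (Mon n) := Fintype.ofFinite _

/-- Monomial evaluation. -/
def mon {n : ℕ} {R : Type*} [CommRing R] (w : Fin n → R) (e : Fin n → ℕ) : R := ∏ i, w i ^ e i

lemma mon_add {n : ℕ} {R : Type*} [CommRing R] (w : Fin n → R) (e f : Fin n → ℕ) :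
    mon w (e + f) = mon w e * mon w f := by
  simp [mon, pow_add, Finset.prod_mul_distrib]

lemma mon_single {n : ℕ} {R : Type*} [CommRing R] (w : Fin n → R) (j : Fin n) :
    mon w (Pi.single j 1) = w j := by
  unfold mon
  rw [Finset.prod_eq_single j]
  · simp
  · intro b _ hb
    simp [Pi.single_eq_of_ne hb]
  · simp

lemma sum_delta {n : ℕ} {R : Type*} [CommRing R] (U : (Fin n → ℕ) → R) (f : Fin n → ℕ)
    (hf : ∑ i, f i ≤ n + 1) :
    ∑ m : Mon n, (if m.1 = f then (1 : R) else 0) * U m.1 = U f := by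
  rw [Finset.sum_eq_single (⟨f, hf⟩ : Mon n)]
  · simp
  · intro b _ hb
    have : b.1 ≠ f := fun h => hb (Subtype.ext h)
    simp [this]
  · simp

open Classical in
/-- The reduction matrix. -/
noncomputable def L {n : ℕ} {R : Type*} [CommRing R] (y : Idx n → R) :
    Matrix (Mon n) (Mon n) R := fun m m' =>
  if h : ∃ i, 2 ≤ m.1 i then
    (∑ j, ∑ k, y (Sum.inl (h.choose, j, k)) *
      (if m'.1 = m.1 - Pi.single h.choose 2 + Pi.single j 1 + Pi.single k 1 then (1 : R) else 0))
    - rhs y h.choose * (if m'.1 = m.1 - Pi.single h.choose 2 then (1 : R) else 0)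
  else (if m'.1 = m.1 then (1 : R) else 0)

lemma sum_single {n : ℕ} (i : Fin n) (a : ℕ) : ∑ k, (Pi.single i a : Fin n → ℕ) k = a := by
  simp

lemma sub_add_two {n : ℕ} (m : Fin n → ℕ) (i : Fin n) (h : 2 ≤ m i) :
    m - Pi.single i 2 + Pi.single i 2 = m := by
  apply tsub_add_cancel_of_le
  intro k
  by_cases hk : k = i
  · subst hk; simpa using h
  · simp [Pi.single_eq_of_ne hk]

lemma sum_sub {n : ℕ} (m : Fin n → ℕ) (i : Fin n) (h : 2 ≤ m i) :
    ∑ k, (m - Pi.single i 2 : Fin n → ℕ) k + 2 = ∑ k, m k := by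
  conv_rhs => rw [← sub_add_two m i h]
  simp only [Pi.add_apply, Finset.sum_add_distrib, sum_single]

lemma L_mulVec {n : ℕ} {R : Type*} [CommRing R] (y : Idx n → R) (U : (Fin n → ℕ) → R)
    (m : Mon n) (h : ∃ i, 2 ≤ m.1 i) :
    (L y *ᵥ (fun m => U m.1)) m =
      (∑ j, ∑ k, y (Sum.inl (h.choose, j, k)) *
        U (m.1 - Pi.single h.choose 2 + Pi.single j 1 + Pi.single k 1))
      - rhs y h.choose * U (m.1 - Pi.single h.choose 2) := by
  have hs := sum_sub m.1 h.choose h.choose_spec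
  have hm := m.2
  simp only [Matrix.mulVec, dotProduct, L, h, dite_true]
  simp only [sub_mul, Finset.sum_sub_distrib, Finset.sum_mul]
  congr 1
  · rw [Finset.sum_comm]
    refine Finset.sum_congr rfl fun j _ => ?_
    rw [Finset.sum_comm]
    refine Finset.sum_congr rfl fun k _ => ?_
    simp only [mul_assoc]
    rw [← Finset.mul_sum, sum_delta]
    simp only [Pi.add_apply, Finset.sum_add_distrib, sum_single]
    omega
  · simp only [mul_assoc]
    rw [← Finset.mul_sum, sum_delta]
    omega

lemma L_mulVec' {n : ℕ} {R : Type*} [CommRing R] (y : Idx n → R) (U : (Fin n → ℕ) → R)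
    (m : Mon n) (h : ¬ ∃ i, 2 ≤ m.1 i) :
    (L y *ᵥ (fun m => U m.1)) m = U m.1 := by
  simp only [Matrix.mulVec, dotProduct, L, h, dite_false]
  exact sum_delta _ _ m.2

/-- Indicator exponent. -/
def ind {n : ℕ} (S : Finset (Fin n)) : Fin n → ℕ := fun i => if i ∈ S then 1 else 0

lemma sum_ind {n : ℕ} (S : Finset (Fin n)) : ∑ i, ind S i ≤ n := by
  calc ∑ i, ind S i ≤ ∑ i : Fin n, 1 := Finset.sum_le_sum fun i _ => by
        unfold ind; split_ifs <;> simp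
    _ = n := by simp

/-- Square-free monomial. -/
def sq {n : ℕ} (S : Finset (Fin n)) : Mon n := ⟨ind S, (sum_ind S).trans (Nat.le_succ _)⟩

/-- Square-free monomial times a variable. -/
def sqX {n : ℕ} (j : Fin n) (S : Finset (Fin n)) : Mon n := ⟨ind S + Pi.single j 1, by
  have := sum_ind S
  simp only [Pi.add_apply, Finset.sum_add_distrib, sum_single]
  omega⟩

lemma sq_injective {n : ℕ} : Function.Injective (sq (n := n)) := by
  intro S T h
  have h := congrArg Subtype.val h
  ext i
  have := congrFun h i
  simp only [sq, ind] at this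
  by_cases h1 : i ∈ S <;> by_cases h2 : i ∈ T <;> simp_all

/-- Vector of square-free monomials. -/
def vec {n : ℕ} {R : Type*} [CommRing R] (w : Fin n → R) : Finset (Fin n) → R :=
  fun S => mon w (ind S)

/-- Scaled multiplication matrices. -/
noncomputable def N {n : ℕ} {R : Type*} [CommRing R] (y : Idx n → R) (j : Fin n) :
    Matrix (Finset (Fin n)) (Finset (Fin n)) R :=
  fun S S' => (L y).adjugate (sqX j S) (sq S')

lemma N_mulVec {n : ℕ} {R : Type*} [CommRing R] (y : Idx n → R) (w : Fin n → R)
    (hw : IsSol y w) (j : Fin n) :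
    N y j *ᵥ vec w = ((L y).det * w j) • vec w := by
  classical
  have h1 : L y *ᵥ (fun m => mon w m.1) =
      fun m => if ∃ i, 2 ≤ m.1 i then 0 else mon w m.1 := by
    funext m
    by_cases h : ∃ i, 2 ≤ m.1 i
    · rw [L_mulVec _ _ _ h, if_pos h]
      simp only [mon_add, mon_single]
      rw [← hw h.choose, Finset.sum_mul, sub_eq_zero]
      refine Finset.sum_congr rfl fun j _ => ?_
      rw [Finset.sum_mul]
      refine Finset.sum_congr rfl fun k _ => ?_
      ring
    · rw [L_mulVec' _ _ _ h, if_neg h]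
  have h2 := congrArg (fun v => (L y).adjugate *ᵥ v) h1
  simp only [Matrix.mulVec_mulVec, Matrix.adjugate_mul, Matrix.smul_mulVec, Matrix.one_mulVec] at h2
  funext S
  have h3 := congrFun h2 (sqX j S)
  simp only [Pi.smul_apply, smul_eq_mul] at h3 ⊢
  have h4 : mon w (sqX j S).1 = w j * vec w S := by
    simp only [sqX, mon_add, mon_single, vec]; ring
  rw [h4, ← mul_assoc] at h3
  rw [h3]
  simp only [Matrix.mulVec, dotProduct]
  apply Fintype.sum_of_injective sq sq_injective
  · intro m hm
    have : ∃ i, 2 ≤ m.1 i := by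
      by_contra hc
      push Not at hc
      apply hm
      refine ⟨Finset.univ.filter (fun i => m.1 i = 1), Subtype.ext ?_⟩
      funext i
      have := hc i
      simp only [sq, ind, Finset.mem_filter, Finset.mem_univ, true_and]
      split_ifs <;> omega
    simp [this]
  · intro T
    have : ¬ ∃ i, 2 ≤ (sq T).1 i := by
      push Not
      intro i
      simp only [sq, ind]
      split_ifs <;> omega
    simp only [this, if_false]
    rfl

/-- Linear form separating the base solutions. -/
def lam {n : ℕ} {R : Type*} [CommRing R] (w : Fin n → R) : R := ∑ j : Fin n, 2 ^ (j : ℕ) * w j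

/-- Scaled multiplication by the separating form. -/
noncomputable def M {n : ℕ} {R : Type*} [CommRing R] (y : Idx n → R) :
    Matrix (Finset (Fin n)) (Finset (Fin n)) R := ∑ j : Fin n, (2 ^ (j : ℕ) : R) • N y j

lemma M_mulVec_of {n : ℕ} {R : Type*} [CommRing R] (y : Idx n → R) (w : Fin n → R)
    (v : Finset (Fin n) → R) (hv : ∀ j, N y j *ᵥ v = ((L y).det * w j) • v) :
    M y *ᵥ v = ((L y).det * lam w) • v := by
  simp only [M, Matrix.sum_mulVec, Matrix.smul_mulVec, hv, lam]
  rw [Finset.mul_sum, Finset.sum_smul]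
  refine Finset.sum_congr rfl fun j _ => ?_
  rw [smul_smul]; congr 1; ring

/-! Naturality -/

lemma L_map {n : ℕ} {R S : Type*} [CommRing R] [CommRing S] (φ : R →+* S) (y : Idx n → R) :
    (L y).map φ = L (fun s => φ (y s)) := by
  ext m m'
  simp only [Matrix.map_apply, L, rhs]
  split_ifs <;> simp [apply_ite φ]

lemma N_map {n : ℕ} {R S : Type*} [CommRing R] [CommRing S] (φ : R →+* S) (y : Idx n → R)
    (j : Fin n) : (N y j).map φ = N (fun s => φ (y s)) j := by
  ext S S'
  simp only [N, ← L_map, Matrix.map_apply]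
  have := φ.map_adjugate (L y)
  simp only [RingHom.mapMatrix_apply] at this
  rw [← this]; rfl

lemma M_map {n : ℕ} {R S : Type*} [CommRing R] [CommRing S] (φ : R →+* S) (y : Idx n → R) :
    (M y).map φ = M (fun s => φ (y s)) := by
  ext a b
  simp only [M, ← N_map, Matrix.map_apply, Matrix.sum_apply, Matrix.smul_apply, smul_eq_mul,
    map_sum, map_mul, map_pow, map_ofNat]

lemma det_map {n : ℕ} {R S : Type*} [CommRing R] [CommRing S] (φ : R →+* S) (y : Idx n → R) :
    φ (L y).det = (L (fun s => φ (y s))).det := by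
  rw [← L_map, RingHom.map_det, RingHom.mapMatrix_apply]

lemma rhs_map {n : ℕ} {R S : Type*} [CommRing R] [CommRing S] (φ : R →+* S) (y : Idx n → R)
    (i : Fin n) : φ (rhs y i) = rhs (fun s => φ (y s)) i := by
  simp [rhs]

/-! Consequences of having many solutions -/

lemma vec_ne_zero {n : ℕ} (w : Fin n → ℂ) : vec w ≠ 0 := by
  intro h
  have := congrFun h ∅
  simp [vec, mon, ind] at this

/-- The three consequences. -/
lemma many_sols {n : ℕ} (y : Idx n → ℂ) (hd : (L y).det ≠ 0)
    (w : Finset (Fin n) → Fin n → ℂ) (hw : ∀ S, IsSol y (w S))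
    (hinj : Function.Injective (fun S => lam (w S))) :
    (∀ j k, N y j * N y k = N y k * N y j) ∧
    (∀ i, ∑ j, ∑ k, y (Sum.inl (i, j, k)) • (N y j * N y k) =
      ((L y).det ^ 2 * rhs y i) • (1 : Matrix (Finset (Fin n)) (Finset (Fin n)) ℂ)) ∧
    (M y).charpoly.Separable := by
  classical
  have hN := fun S j => N_mulVec y (w S) (hw S) j
  have hM := fun S => M_mulVec_of y (w S) _ (hN S)
  have hinj' : Function.Injective (fun S => (L y).det * lam (w S)) := fun a b h =>
    hinj (mul_left_cancel₀ hd h)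
  have hli : LinearIndependent ℂ (fun S => vec (w S)) := by
    refine Module.End.eigenvectors_linearIndependent' (Matrix.toLin' (M y)) _ hinj' _ ?_
    intro S
    rw [Module.End.hasEigenvector_iff, Module.End.mem_eigenspace_iff]
    refine ⟨?_, vec_ne_zero _⟩
    rw [Matrix.toLin'_apply]; exact hM S
  have hV : IsUnit (Matrix.of (fun S => vec (w S)))ᵀ := by
    rw [Matrix.isUnit_transpose]
    exact Matrix.linearIndependent_rows_iff_isUnit.1 hli
  have hext : ∀ A B : Matrix (Finset (Fin n)) (Finset (Fin n)) ℂ,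
      (∀ S, A *ᵥ vec (w S) = B *ᵥ vec (w S)) → A = B := by
    intro A B h
    apply hV.mul_right_cancel
    ext a S
    exact congrFun (h S) a
  refine ⟨?_, ?_, ?_⟩
  · intro j k
    apply hext
    intro S
    simp only [← Matrix.mulVec_mulVec, hN, Matrix.mulVec_smul, smul_smul]
    congr 1; ring
  · intro i
    apply hext
    intro S
    simp only [← Matrix.mulVec_mulVec, hN, Matrix.mulVec_smul, smul_smul, Matrix.sum_mulVec,
      Matrix.smul_mulVec, Matrix.one_mulVec]
    simp only [← Finset.sum_smul]
    congr 1
    rw [← hw S i, Finset.mul_sum]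
    refine Finset.sum_congr rfl fun j _ => ?_
    rw [Finset.mul_sum]
    refine Finset.sum_congr rfl fun k _ => ?_
    ring
  · obtain ⟨V, hVe⟩ := hV
    have h1 : M y * V.val = V.val * Matrix.diagonal (fun S => (L y).det * lam (w S)) := by
      rw [hVe]
      ext a S
      rw [Matrix.mul_diagonal]
      have := congrFun (hM S) a
      simp only [Pi.smul_apply, smul_eq_mul] at this
      rw [mul_comm]
      exact this
    have h2 : M y = V.val * Matrix.diagonal (fun S => (L y).det * lam (w S)) * V⁻¹.val := by
      rw [← h1, mul_assoc]; simp
    rw [h2, Matrix.coe_units_inv, Matrix.charpoly_units_conj, Matrix.charpoly_diagonal]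
    exact Polynomial.separable_prod_X_sub_C_iff.2 hinj'

/-- Exact count from the identities. -/
lemma count {n : ℕ} (y : Idx n → ℂ) (hd : (L y).det ≠ 0)
    (hc : ∀ j k, N y j * N y k = N y k * N y j)
    (hq : ∀ i, ∑ j, ∑ k, y (Sum.inl (i, j, k)) • (N y j * N y k) =
      ((L y).det ^ 2 * rhs y i) • (1 : Matrix (Finset (Fin n)) (Finset (Fin n)) ℂ))
    (hs : (M y).charpoly.Separable) : Set.ncard {w | IsSol y w} = 2 ^ n := by
  classical
  have h1d : ∀ μ : ℂ, ∀ v ≠ 0, M y *ᵥ v = μ • v → ∀ u, M y *ᵥ u = μ • u → ∃ c : ℂ, u = c • v := by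
    intro μ v hv hMv u hMu
    have h1 := LinearMap.finrank_eigenspace_le (Matrix.toLin' (M y)) μ
    rw [Matrix.charpoly_toLin'] at h1
    have h2 := Polynomial.rootMultiplicity_le_one_of_separable hs μ
    have h3 := h1.trans h2
    have hv' : v ∈ Module.End.eigenspace (Matrix.toLin' (M y)) μ := by
      rw [Module.End.mem_eigenspace_iff, Matrix.toLin'_apply]; exact hMv
    have hu' : u ∈ Module.End.eigenspace (Matrix.toLin' (M y)) μ := by
      rw [Module.End.mem_eigenspace_iff, Matrix.toLin'_apply]; exact hMu
    rw [finrank_le_one_iff] at h3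
    obtain ⟨t, ht⟩ := h3
    obtain ⟨a, ha⟩ := ht ⟨v, hv'⟩
    obtain ⟨b, hb⟩ := ht ⟨u, hu'⟩
    have ha := congrArg Subtype.val ha
    have hb := congrArg Subtype.val hb
    simp only [Submodule.coe_smul] at ha hb
    have ha0 : a ≠ 0 := by
      rintro rfl; apply hv; rw [← ha]; simp
    refine ⟨b / a, ?_⟩
    rw [← ha, ← hb, smul_smul, div_mul_cancel₀ _ ha0]
  have hbij : Set.BijOn (fun w => (L y).det * lam w) {w | IsSol y w}
      ((M y).charpoly.rootSet ℂ) := by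
    have hroot : ∀ μ : ℂ, μ ∈ (M y).charpoly.rootSet ℂ ↔ ∃ v ≠ 0, M y *ᵥ v = μ • v := by
      intro μ
      rw [Polynomial.mem_rootSet, Polynomial.coe_aeval_eq_eval, ← Polynomial.IsRoot.def,
        ← Matrix.charpoly_toLin', ← Module.End.hasEigenvalue_iff_isRoot_charpoly]
      constructor
      · rintro ⟨_, h⟩
        obtain ⟨v, hv⟩ := h.exists_hasEigenvector
        refine ⟨v, hv.2, ?_⟩
        have := hv.apply_eq_smul
        rwa [Matrix.toLin'_apply] at this
      · rintro ⟨v, hv, h⟩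
        refine ⟨LinearMap.charpoly_monic _ |>.ne_zero, ?_⟩
        apply Module.End.hasEigenvalue_of_hasEigenvector (x := v)
        rw [Module.End.hasEigenvector_iff, Module.End.mem_eigenspace_iff, Matrix.toLin'_apply]
        exact ⟨h, hv⟩
    refine ⟨?_, ?_, ?_⟩
    · intro w hw
      rw [hroot]
      exact ⟨vec w, vec_ne_zero w, M_mulVec_of _ _ _ (N_mulVec y w hw)⟩
    · intro w hw w' hw' h
      have h1 := M_mulVec_of _ _ _ (N_mulVec y w hw)
      have h2 := M_mulVec_of _ _ _ (N_mulVec y w' hw')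
      simp only at h
      rw [← h] at h2
      obtain ⟨c, hc⟩ := h1d _ _ (vec_ne_zero w) h1 _ h2
      have hc1 : c = 1 := by
        have := congrFun hc ∅
        simpa [vec, mon, ind] using this.symm
      rw [hc1, one_smul] at hc
      funext j
      have h3 : ∀ u : Fin n → ℂ, vec u {j} = u j := by
        intro u
        have : ind {j} = Pi.single j 1 := by
          funext i
          by_cases hi : i = j
          · subst hi; simp [ind]
          · simp [ind, hi]
        rw [vec, this, mon_single]
      rw [← h3 w, ← h3 w', hc]
    · intro μ hμ
      obtain ⟨v, hv, hMv⟩ := (hroot μ).1 hμ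
      have hcM : ∀ j, M y * N y j = N y j * M y := by
        intro j
        simp only [M, Finset.sum_mul, Finset.mul_sum, Matrix.smul_mul, Matrix.mul_smul, hc j]
      have : ∀ j, ∃ c : ℂ, N y j *ᵥ v = c • v := by
        intro j
        apply h1d μ v hv hMv
        rw [Matrix.mulVec_mulVec, hcM, ← Matrix.mulVec_mulVec, hMv, Matrix.mulVec_smul]
      choose c hcv using this
      have hcv' : ∀ j, N y j *ᵥ v = ((L y).det * (c j / (L y).det)) • v := by
        intro j; rw [mul_div_cancel₀ _ hd]; exact hcv j
      refine ⟨fun j => c j / (L y).det, ?_, ?_⟩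
      · intro i
        have h := congrArg (fun A => A *ᵥ v) (hq i)
        simp only [← Matrix.mulVec_mulVec, hcv', Matrix.mulVec_smul, smul_smul, Matrix.sum_mulVec,
          Matrix.smul_mulVec, Matrix.one_mulVec] at h
        simp only [← Finset.sum_smul] at h
        have h := smul_left_injective ℂ hv h
        apply mul_left_cancel₀ (pow_ne_zero 2 hd)
        rw [← h, Finset.mul_sum]
        refine Finset.sum_congr rfl fun j _ => ?_
        rw [Finset.mul_sum]
        refine Finset.sum_congr rfl fun k _ => ?_
        ring
      · have h := M_mulVec_of y _ v hcv'
        rw [hMv] at h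
        exact (smul_left_injective ℂ hv h).symm
  have h1 := hbij.image_eq
  have h2 := hbij.injOn.ncard_image
  rw [← h2, h1, Set.ncard_eq_toFinset_card', Set.toFinset_card,
    Polynomial.card_rootSet_eq_natDegree hs (IsAlgClosed.splits _),
    Matrix.charpoly_natDegree_eq_dim]
  simp

/-! The base point -/

/-- The base point: `A_i = e_i e_iᵀ`, `z = (1, …, 1)`. -/
noncomputable def y0 (n : ℕ) : Idx n → ℂ :=
  Sum.elim (fun t => if t.1 = t.2.1 ∧ t.1 = t.2.2 then 1 else 0) (fun _ => 1)

lemma y0_sum {n : ℕ} (i : Fin n) (f : Fin n → Fin n → ℂ) :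
    ∑ j, ∑ k, y0 n (Sum.inl (i, j, k)) * f j k = f i i := by
  rw [Finset.sum_eq_single i, Finset.sum_eq_single i]
  · simp [y0]
  · intro b _ hb; simp [y0, hb.symm]
  · simp
  · intro b _ hb; simp [y0, hb.symm]
  · simp

lemma rhs_y0 {n : ℕ} (i : Fin n) : rhs (y0 n) i = 1 := by
  rw [rhs, y0_sum]; simp [y0]

lemma L_y0_mulVec {n : ℕ} (U : (Fin n → ℕ) → ℂ) (m : Mon n) (h : ∃ i, 2 ≤ m.1 i) :
    (L (y0 n) *ᵥ (fun m => U m.1)) m = U m.1 - U (m.1 - Pi.single h.choose 2) := by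
  rw [L_mulVec _ _ _ h, rhs_y0, one_mul]
  congr 1
  have e : U m.1 = U (m.1 - Pi.single h.choose 2 + Pi.single h.choose 1 +
      Pi.single h.choose 1) := by
    rw [add_assoc, ← Pi.single_add, sub_add_two _ _ h.choose_spec]
  rw [e]
  generalize h.choose = i
  have hf : ∀ f : Fin n → Fin n → Fin n → ℕ,
      ∑ j, ∑ k, y0 n (Sum.inl (i, j, k)) * U (f j k) = U (f i i) :=
    fun f => y0_sum i (fun j k => U (f j k))
  exact hf (fun j k => m.1 - Pi.single i 2 + Pi.single j 1 + Pi.single k 1)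

lemma det_y0 (n : ℕ) : (L (y0 n)).det ≠ 0 := by
  intro h
  obtain ⟨v, hv, hL⟩ := Matrix.exists_mulVec_eq_zero_iff.2 h
  apply hv
  let U : (Fin n → ℕ) → ℂ := fun e => if h : ∑ i, e i ≤ n + 1 then v ⟨e, h⟩ else 0
  have hU : v = fun m : Mon n => U m.1 := by
    funext m
    simp only [U, m.2, dite_true]
  rw [hU] at hL
  have key : ∀ d : ℕ, ∀ m : Mon n, ∑ i, m.1 i = d → U m.1 = 0 := by
    intro d
    induction d using Nat.strong_induction_on with
    | _ d ih =>
      intro m hm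
      have h1 := congrFun hL m
      by_cases h : ∃ i, 2 ≤ m.1 i
      · rw [L_y0_mulVec _ _ h] at h1
        have hs := sum_sub m.1 h.choose h.choose_spec
        have hm2 := m.2
        have h2 := ih (∑ k, (m.1 - Pi.single h.choose 2 : Fin n → ℕ) k) (by omega)
          ⟨m.1 - Pi.single h.choose 2, by omega⟩ rfl
        rw [h2] at h1
        simpa using h1
      · rw [L_mulVec' _ _ _ h] at h1
        simpa using h1
  rw [hU]
  funext m
  exact key _ m rfl

/-- Base solutions. -/
noncomputable def eps {n : ℕ} (S : Finset (Fin n)) : Fin n → ℂ := fun i => if i ∈ S then 1 else -1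

lemma eps_sq {n : ℕ} (S : Finset (Fin n)) (i : Fin n) : eps S i * eps S i = 1 := by
  unfold eps; split_ifs <;> simp

lemma eps_ne {n : ℕ} (S : Finset (Fin n)) (i : Fin n) : eps S i ≠ 0 := by
  unfold eps; split_ifs <;> simp

lemma eps_sol {n : ℕ} (S : Finset (Fin n)) : IsSol (y0 n) (eps S) := by
  intro i
  rw [y0_sum i (fun j k => eps S j * eps S k), rhs_y0, eps_sq]

lemma lam_eps_inj {n : ℕ} : Function.Injective (fun S : Finset (Fin n) => lam (eps S)) := by
  have h : ∀ S : Finset (Fin n), lam (eps S) =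
      2 * ((∑ i ∈ S.map Fin.valEmbedding, 2 ^ i : ℕ) : ℂ) - ∑ j : Fin n, 2 ^ (j : ℕ) := by
    intro S
    rw [Finset.sum_map]
    push_cast
    have : ∑ x ∈ S, (2 : ℂ) ^ (x : ℕ) = ∑ x : Fin n, if x ∈ S then (2 : ℂ) ^ (x : ℕ) else 0 := by
      simp
    simp only [Fin.valEmbedding_apply]
    rw [this, Finset.mul_sum, ← Finset.sum_sub_distrib, lam]
    refine Finset.sum_congr rfl fun j _ => ?_
    unfold eps
    split_ifs <;> ring
  intro S T hST
  simp only [h] at hST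
  have h1 : ((∑ i ∈ S.map Fin.valEmbedding, 2 ^ i : ℕ) : ℂ) =
      ((∑ i ∈ T.map Fin.valEmbedding, 2 ^ i : ℕ) : ℂ) := by
    linear_combination hST / 2
  have h2 := Finset.geomSum_injective (le_refl 2) (Nat.cast_injective h1)
  exact Finset.map_injective _ h2

/-- The map for the implicit function argument. -/
noncomputable def G (n : ℕ) (p : (Idx n → ℂ) × (Fin n → ℂ)) : (Idx n → ℂ) × (Fin n → ℂ) :=
  (p.1, fun i => ∑ j, ∑ k, p.1 (Sum.inl (i, j, k)) *
    (p.2 j * p.2 k - p.1 (Sum.inr j) * p.1 (Sum.inr k)))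

lemma G_sol {n : ℕ} (y : Idx n → ℂ) (w : Fin n → ℂ) : G n (y, w) = (y, 0) ↔ IsSol y w := by
  simp only [G, Prod.mk.injEq, true_and, funext_iff, IsSol, rhs, mul_sub, Finset.sum_sub_distrib,
    sub_eq_zero, Pi.zero_apply]

lemma G_contDiff (n : ℕ) : ContDiff ℂ 1 (G n) := by
  unfold G
  fun_prop

lemma G_nhds {n : ℕ} (S : Finset (Fin n)) :
    Filter.map (G n) (nhds (y0 n, eps S)) = nhds (y0 n, 0) := by
  have hs : HasStrictFDerivAt (G n) (fderiv ℂ (G n) (y0 n, eps S)) (y0 n, eps S) :=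
    (G_contDiff n).contDiffAt.hasStrictFDerivAt one_ne_zero
  have hG : G n (y0 n, eps S) = (y0 n, 0) := (G_sol _ _).2 (eps_sol S)
  rw [← hG]
  apply hs.map_nhds_eq_of_surj
  set G' := fderiv ℂ (G n) (y0 n, eps S)
  have hd : HasFDerivAt (G n) G' (y0 n, eps S) := hs.hasFDerivAt
  have h1 : ∀ p, (G' p).1 = p.1 := by
    intro p
    have a := (hasFDerivAt_fst (𝕜 := ℂ) (p := G n (y0 n, eps S))).comp _ hd
    have b := hasFDerivAt_fst (𝕜 := ℂ) (E := Idx n → ℂ) (F := Fin n → ℂ) (p := (y0 n, eps S))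
    have := a.unique b
    exact DFunLike.congr_fun this p
  have h2 : ∀ u : Fin n → ℂ, G' (0, u) = (0, fun i => 2 * eps S i * u i) := by
    intro u
    have a : HasFDerivAt (fun w => G n (y0 n, w)) _ (eps S) :=
      HasFDerivAt.comp (eps S) hd (hasFDerivAt_prodMk_right (y0 n) (eps S))
    have e : (fun w => G n (y0 n, w)) = fun w => (y0 n, fun i => w i * w i - 1) := by
      funext w
      simp only [G, Prod.mk.injEq, true_and]
      funext i
      rw [y0_sum i (fun j k => w j * w k - y0 n (Sum.inr j) * y0 n (Sum.inr k))]
      simp [y0]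
    rw [e] at a
    have a2 := (hasFDerivAt_snd (𝕜 := ℂ)).comp _ a
    refine Prod.ext (h1 _) ?_
    funext i
    have a3 := (hasFDerivAt_pi'.1 a2) i
    have b : HasFDerivAt (fun w : Fin n → ℂ => w i * w i - 1) _ (eps S) :=
      ((hasFDerivAt_apply (𝕜 := ℂ) i (eps S)).mul (hasFDerivAt_apply i (eps S))).sub_const 1
    have c := DFunLike.congr_fun (a3.unique b) u
    simp at c
    simp only
    rw [c]; ring
  rw [LinearMap.range_eq_top]
  rintro ⟨a, b⟩
  refine ⟨(a, fun i => (b i - (G' (a, 0)).2 i) / (2 * eps S i)), ?_⟩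
  have : (a, fun i => (b i - (G' (a, 0)).2 i) / (2 * eps S i)) =
      (a, (0 : Fin n → ℂ)) + ((0 : Idx n → ℂ), fun i => (b i - (G' (a, 0)).2 i) / (2 * eps S i)) := by
    simp
  rw [this]
  show G' _ = _
  rw [map_add, h2]
  refine Prod.ext ?_ ?_
  · simp [h1]
  · funext i
    have := eps_ne S i
    simp only [Prod.snd_add, Pi.add_apply]
    field_simp
    ring

lemma eventually_many (n : ℕ) : ∀ᶠ y in nhds (y0 n), (L y).det ≠ 0 ∧
    ∃ w : Finset (Fin n) → Fin n → ℂ, (∀ S, IsSol y (w S)) ∧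
      Function.Injective (fun S => lam (w S)) := by
  have h1 : ∀ᶠ y in nhds (y0 n), (L y).det ≠ 0 := by
    have hc : Continuous fun y : Idx n → ℂ =>
        MvPolynomial.eval y (L (fun s => MvPolynomial.X (R := ℂ) s)).det :=
      MvPolynomial.continuous_eval _
    have he : ∀ y : Idx n → ℂ,
        MvPolynomial.eval y (L (fun s => MvPolynomial.X (R := ℂ) s)).det = (L y).det := by
      intro y
      rw [det_map]; simp
    simp only [he] at hc
    exact hc.continuousAt.eventually_ne (det_y0 n)
  obtain ⟨O, hO, hdis⟩ := (Set.finite_range (fun S : Finset (Fin n) => lam (eps S))).t2_separation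
  have hlam : Continuous (lam : (Fin n → ℂ) → ℂ) := by
    unfold lam; fun_prop
  have h2 : ∀ S : Finset (Fin n), ∀ᶠ y in nhds (y0 n), ∃ w, IsSol y w ∧
      lam w ∈ O (lam (eps S)) := by
    intro S
    have hmem : {p : (Idx n → ℂ) × (Fin n → ℂ) | lam p.2 ∈ O (lam (eps S))} ∈
        nhds (y0 n, eps S) := by
      apply (hlam.comp continuous_snd).continuousAt.preimage_mem_nhds
      exact (hO _).2.mem_nhds (hO _).1
    have him := Filter.image_mem_map (m := G n) hmem
    rw [G_nhds] at him
    have hcont : ContinuousAt (fun y : Idx n → ℂ => (y, (0 : Fin n → ℂ))) (y0 n) := by fun_prop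
    filter_upwards [hcont.preimage_mem_nhds him] with y hy
    obtain ⟨⟨y', w⟩, hp, hpe⟩ := hy
    have : y' = y := congrArg Prod.fst hpe
    subst this
    exact ⟨w, (G_sol _ _).1 hpe, hp⟩
  filter_upwards [h1, Filter.eventually_all.2 h2] with y hy1 hy2
  refine ⟨hy1, ?_⟩
  choose w hw hwO using hy2
  refine ⟨w, hw, ?_⟩
  intro S T hST
  by_contra hne
  have hd := hdis (Set.mem_range_self S) (Set.mem_range_self T) (fun h => hne (lam_eps_inj h))
  refine Set.disjoint_left.1 hd (hwO S) ?_
  simp only at hST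
  rw [hST]
  exact hwO T

lemma poly_eq_of_eventually {σ : Type*} [Finite σ] (a : σ → ℂ) (p q : MvPolynomial σ ℂ)
    (h : ∀ᶠ y in nhds a, MvPolynomial.eval y p = MvPolynomial.eval y q) : p = q := by
  have := Fintype.ofFinite σ
  rw [Filter.Eventually, nhds_pi, Filter.mem_pi'] at h
  obtain ⟨I, t, ht, hsub⟩ := h
  apply MvPolynomial.funext_set t
  · intro i
    exact infinite_of_mem_nhds _ (ht i)
  · intro x hx
    apply hsub
    intro i _
    exact hx i (Set.mem_univ i)

/-- The generic point. -/
noncomputable def gen (n : ℕ) : Idx n → MvPolynomial (Idx n) ℂ := fun s => MvPolynomial.X s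

lemma eval_gen {n : ℕ} (y : Idx n → ℂ) : (fun s => MvPolynomial.eval y (gen n s)) = y := by
  funext s; simp [gen]

lemma eval_N {n : ℕ} (y : Idx n → ℂ) (j : Fin n) :
    (N (gen n) j).map (MvPolynomial.eval y) = N y j := by
  rw [N_map, eval_gen]

lemma comm_all {n : ℕ} (y : Idx n → ℂ) (j k : Fin n) : N y j * N y k = N y k * N y j := by
  have : N (gen n) j * N (gen n) k = N (gen n) k * N (gen n) j := by
    ext1 S T
    apply poly_eq_of_eventually (y0 n)
    filter_upwards [eventually_many n] with y hy
    obtain ⟨hd, w, hw, hinj⟩ := hy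
    have h := (many_sols y hd w hw hinj).1 j k
    rw [← eval_N, ← eval_N, ← Matrix.map_mul, ← Matrix.map_mul] at h
    exact congrFun (congrFun h S) T
  rw [← eval_N, ← eval_N, ← Matrix.map_mul, ← Matrix.map_mul, this]

lemma quad_all {n : ℕ} (y : Idx n → ℂ) (i : Fin n) :
    ∑ j, ∑ k, y (Sum.inl (i, j, k)) • (N y j * N y k) =
      ((L y).det ^ 2 * rhs y i) • (1 : Matrix (Finset (Fin n)) (Finset (Fin n)) ℂ) := by
  have hl : ∀ y : Idx n → ℂ, (∑ j, ∑ k, gen n (Sum.inl (i, j, k)) •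
      (N (gen n) j * N (gen n) k)).map (MvPolynomial.eval y) =
      ∑ j, ∑ k, y (Sum.inl (i, j, k)) • (N y j * N y k) := by
    intro y
    have hjk : ∀ j k, N y j * N y k =
        (N (gen n) j * N (gen n) k).map (MvPolynomial.eval y) := by
      intro j k
      rw [Matrix.map_mul, eval_N, eval_N]
    simp only [hjk]
    ext S T
    simp only [Matrix.sum_apply, Matrix.map_apply, Matrix.smul_apply, smul_eq_mul, map_sum,
      map_mul, gen, MvPolynomial.eval_X]
  have hr : ∀ y : Idx n → ℂ, (((L (gen n)).det ^ 2 * rhs (gen n) i) •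
      (1 : Matrix (Finset (Fin n)) (Finset (Fin n)) (MvPolynomial (Idx n) ℂ))).map
        (MvPolynomial.eval y) = ((L y).det ^ 2 * rhs y i) • 1 := by
    intro y
    ext S T
    simp only [Matrix.map_apply, Matrix.smul_apply, smul_eq_mul, map_mul, map_pow, det_map,
      rhs_map, eval_gen, Matrix.one_apply, apply_ite (MvPolynomial.eval y), map_one, map_zero]
  have : ∑ j, ∑ k, gen n (Sum.inl (i, j, k)) • (N (gen n) j * N (gen n) k) =
      ((L (gen n)).det ^ 2 * rhs (gen n) i) • 1 := by
    ext1 S T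
    apply poly_eq_of_eventually (y0 n)
    filter_upwards [eventually_many n] with y hy
    obtain ⟨hd, w, hw, hinj⟩ := hy
    have h := (many_sols y hd w hw hinj).2.1 i
    rw [← hl, ← hr] at h
    exact congrFun (congrFun h S) T
  rw [← hl, ← hr, this]

open Polynomial in
/-- Discriminant of the characteristic polynomial. -/
noncomputable def disc {n : ℕ} {R : Type*} [CommRing R] (y : Idx n → R) : R :=
  resultant (M y).charpoly (derivative (M y).charpoly) (2 ^ n) (2 ^ n - 1)

lemma disc_map {n : ℕ} {R S : Type*} [CommRing R] [CommRing S] (φ : R →+* S) (y : Idx n → R) :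
    φ (disc y) = disc (fun s => φ (y s)) := by
  have h : (M (fun s => φ (y s))).charpoly = (M y).charpoly.map φ := by
    rw [← M_map, Matrix.charpoly_map]
  unfold disc
  rw [h, Polynomial.derivative_map, Polynomial.resultant_map_map]

lemma disc_ne {n : ℕ} (y : Idx n → ℂ) : disc y ≠ 0 ↔ (M y).charpoly.Separable := by
  have h1 : (M y).charpoly.natDegree = 2 ^ n := by
    rw [Matrix.charpoly_natDegree_eq_dim]; simp
  have h2 : (Polynomial.derivative (M y).charpoly).natDegree = 2 ^ n - 1 := by
    rw [Polynomial.natDegree_derivative, h1]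
  have h3 : disc y = Polynomial.resultant (M y).charpoly
      (Polynomial.derivative (M y).charpoly) := by
    unfold disc; rw [h1, h2]
  rw [h3, Ne, Polynomial.resultant_eq_zero_iff, Polynomial.separable_def]
  have : (M y).charpoly ≠ 0 := (Matrix.charpoly_monic _).ne_zero
  simp [this]

/-- The excluded polynomial. -/
noncomputable def bad (n : ℕ) : MvPolynomial (Idx n) ℂ := (L (gen n)).det * disc (gen n)

lemma eval_bad {n : ℕ} (y : Idx n → ℂ) :
    MvPolynomial.eval y (bad n) = (L y).det * disc y := by
  rw [bad, map_mul, det_map, disc_map, eval_gen]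

lemma bad_y0 (n : ℕ) : MvPolynomial.eval (y0 n) (bad n) ≠ 0 := by
  rw [eval_bad]
  exact mul_ne_zero (det_y0 n) ((disc_ne _).2
    (many_sols (y0 n) (det_y0 n) eps eps_sol lam_eps_inj).2.2)

lemma bad_count {n : ℕ} (y : Idx n → ℂ) (h : MvPolynomial.eval y (bad n) ≠ 0) :
    Set.ncard {w | IsSol y w} = 2 ^ n := by
  rw [eval_bad] at h
  exact count y (left_ne_zero_of_mul h) (comm_all y) (quad_all y)
    ((disc_ne y).1 (right_ne_zero_of_mul h))

lemma dot_eq {n : ℕ} (A : Matrix (Fin n) (Fin n) ℂ) (w : Fin n → ℂ) :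
    w ⬝ᵥ A.mulVec w = ∑ j, ∑ k, A j k * (w j * w k) := by
  simp only [Matrix.mulVec, dotProduct, Finset.mul_sum]
  refine Finset.sum_congr rfl fun j _ => Finset.sum_congr rfl fun k _ => ?_
  ring

end QuadCount

/-- For `n ≥ 2` there is a proper Zariski-closed subset `E` of
`(ℂ^{n×n})^n × ℂ^n` such that for every `(A_1, …, A_n, z) ∉ E` the set of `w`
with `wᵀA_i w = zᵀA_i z` for all `i` has exactly `2^n` elements; in particular
some such `w` differs from both `z` and `-z`. Hence `n` measurement matrices
never suffice for (perturbation-stable) generic identifiability. -/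
theorem stmt_7 (n : ℕ) (hn : 2 ≤ n) :
    ∃ T : Set (MvPolynomial ((Fin n × Fin n × Fin n) ⊕ Fin n) ℂ),
      {x : (Fin n → Matrix (Fin n) (Fin n) ℂ) × (Fin n → ℂ) |
          ∀ p ∈ T, MvPolynomial.eval (tupleCoords n x) p = 0} ≠ Set.univ ∧
      ∀ x : (Fin n → Matrix (Fin n) (Fin n) ℂ) × (Fin n → ℂ),
        x ∉ {x | ∀ p ∈ T, MvPolynomial.eval (tupleCoords n x) p = 0} →
        Set.ncard {w : Fin n → ℂ |
            ∀ i : Fin n, w ⬝ᵥ (x.1 i).mulVec w = x.2 ⬝ᵥ (x.1 i).mulVec x.2} = 2 ^ n ∧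
        ∃ w : Fin n → ℂ, w ≠ x.2 ∧ w ≠ -x.2 ∧
          ∀ i : Fin n, w ⬝ᵥ (x.1 i).mulVec w = x.2 ⬝ᵥ (x.1 i).mulVec x.2 := by
  classical
  refine ⟨{QuadCount.bad n}, ?_, ?_⟩
  · intro h
    have h0 : (fun i => Matrix.of fun j k => QuadCount.y0 n (Sum.inl (i, j, k)),
        fun j => QuadCount.y0 n (Sum.inr j)) ∈
        {x : (Fin n → Matrix (Fin n) (Fin n) ℂ) × (Fin n → ℂ) |
          ∀ p ∈ ({QuadCount.bad n} : Set _), MvPolynomial.eval (tupleCoords n x) p = 0} := by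
      rw [h]; trivial
    have h1 := h0 _ rfl
    apply QuadCount.bad_y0 n
    convert h1 using 3
    funext s
    rcases s with ⟨i, j, k⟩ | j <;> rfl
  · intro x hx
    have hx' : MvPolynomial.eval (tupleCoords n x) (QuadCount.bad n) ≠ 0 := by
      intro h
      apply hx
      rintro p rfl
      exact h
    have hset : {w : Fin n → ℂ |
        ∀ i : Fin n, w ⬝ᵥ (x.1 i).mulVec w = x.2 ⬝ᵥ (x.1 i).mulVec x.2} =
        {w | QuadCount.IsSol (tupleCoords n x) w} := by
      ext w
      simp only [Set.mem_ofPred_eq, QuadCount.dot_eq]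
      rfl
    have hcard := QuadCount.bad_count _ hx'
    rw [← hset] at hcard
    refine ⟨hcard, ?_⟩
    by_contra hno
    push Not at hno
    have hsub : {w : Fin n → ℂ |
        ∀ i : Fin n, w ⬝ᵥ (x.1 i).mulVec w = x.2 ⬝ᵥ (x.1 i).mulVec x.2} ⊆ {x.2, -x.2} := by
      intro w hw
      by_contra hc
      simp only [Set.mem_insert_iff, Set.mem_singleton_iff, not_or] at hc
      obtain ⟨i, hi⟩ := hno w hc.1 hc.2
      exact hi (hw i)
    have h1 := Set.ncard_le_ncard hsub (Set.toFinite _)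
    have h2 := Set.ncard_insert_le x.2 {-x.2}
    rw [Set.ncard_singleton] at h2
    have h3 : 2 ^ 2 ≤ 2 ^ n := Nat.pow_le_pow_right (by norm_num) hn
    omega
end

section
/- Let X ⊆ ℂ^n be a Zariski-closed set that is defined over the reals, i.e., X equals the complex Zariski closure of its real part X_ℝ := X ∩ ℝ^n. Then X is observable over the reals: the Krull dimension of X_ℝ in the real Zariski topology of ℝ^n equals the Krull dimension of X in the complex Zariski topology of ℂ^n. -/
/-- The Zariski topology on `σ → K`: the topology generated by the basic open
sets `{x | p(x) ≠ 0}` for polynomials `p`; its closed sets are exactly the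
common zero sets of families of polynomials over `K`. -/
def zariskiTopology (σ K : Type*) [CommSemiring K] : TopologicalSpace (σ → K) :=
  TopologicalSpace.generateFrom
    {U | ∃ p : MvPolynomial σ K, U = {x | MvPolynomial.eval x p ≠ 0}}

open MvPolynomial in
theorem zar_isClosed_iff {σ K : Type*} [Field K] (S : Set (σ → K)) :
    @IsClosed _ (zariskiTopology σ K) S ↔ ∃ I : Ideal (MvPolynomial σ K), S = zeroLocus K I := by
  let t := zariskiTopology σ K
  constructor
  · intro h
    have h' : TopologicalSpace.GenerateOpen
      {U | ∃ p : MvPolynomial σ K, U = {x | MvPolynomial.eval x p ≠ 0}} Sᶜ := h.1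
    rw [← compl_compl S]
    generalize Sᶜ = U at h'
    clear h
    induction h' with
    | basic s hs =>
      obtain ⟨p, rfl⟩ := hs
      refine ⟨Ideal.span {p}, ?_⟩
      rw [zeroLocus_span]
      ext x
      simp [aeval_eq_eval]
    | univ => exact ⟨⊤, by simp⟩
    | inter s t _ _ hs ht =>
      obtain ⟨I, hI⟩ := hs
      obtain ⟨J, hJ⟩ := ht
      refine ⟨I * J, ?_⟩
      rw [Set.compl_inter, hI, hJ]
      ext x
      constructor
      · rintro (h | h)
        · exact zeroLocus_anti_mono Ideal.mul_le_left h
        · exact zeroLocus_anti_mono Ideal.mul_le_right h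
      · intro h
        by_contra hc
        simp only [Set.mem_union, not_or, mem_zeroLocus_iff, not_forall] at hc
        obtain ⟨⟨p, hp, hp0⟩, ⟨q, hq, hq0⟩⟩ := hc
        have := h (p * q) (Ideal.mul_mem_mul hp hq)
        rw [map_mul] at this
        exact (mul_ne_zero hp0 hq0) this
    | sUnion T _ hT =>
      choose! I hI using hT
      refine ⟨⨆ s ∈ T, I s, ?_⟩
      ext x
      constructor
      · intro h
        have : (⨆ s ∈ T, I s) ≤ vanishingIdeal K {x} := by
          refine iSup₂_le fun s hs p hp => ?_
          have hx : x ∈ sᶜ := fun hxs => h ⟨s, hs, hxs⟩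
          rw [hI s hs] at hx
          rw [mem_vanishingIdeal_singleton_iff]
          exact hx p hp
        intro p hp
        exact this hp x rfl
      · rintro h ⟨s, hs, hxs⟩
        have : x ∈ sᶜ := by
          rw [hI s hs]
          exact zeroLocus_anti_mono (le_iSup₂_of_le s hs le_rfl) h
        exact this hxs
  · rintro ⟨I, rfl⟩
    have : zeroLocus K I = ⋂ p ∈ I, {x : σ → K | MvPolynomial.eval x p ≠ 0}ᶜ := by
      ext x; simp [aeval_eq_eval]
    rw [this]
    refine isClosed_biInter fun p _ => ?_
    rw [isClosed_compl_iff]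
    exact TopologicalSpace.isOpen_generateFrom_of_mem ⟨p, rfl⟩

open MvPolynomial in
theorem zar_isClosed_induced_iff {σ K α : Type*} [Field K] (v : α → (σ → K)) (S : Set α) :
    @IsClosed _ (TopologicalSpace.induced v (zariskiTopology σ K)) S ↔
      ∃ I : Ideal (MvPolynomial σ K), S = v ⁻¹' zeroLocus K I := by
  let t := zariskiTopology σ K
  rw [isClosed_induced_iff]
  constructor
  · rintro ⟨t, ht, rfl⟩
    obtain ⟨I, rfl⟩ := (zar_isClosed_iff t).1 ht
    exact ⟨I, rfl⟩
  · rintro ⟨I, rfl⟩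
    exact ⟨_, (zar_isClosed_iff _).2 ⟨I, rfl⟩, rfl⟩

open MvPolynomial in
/-- chain of irreducible closed sets to chain of primes -/
theorem zar_chain_to_primes {σ K α : Type*} [Field K] [t : TopologicalSpace α] (v : α → (σ → K))
    (ht : ∀ S : Set α, IsClosed S ↔ ∃ I : Ideal (MvPolynomial σ K), S = v ⁻¹' zeroLocus K I)
    (c : LTSeries (TopologicalSpace.IrreducibleCloseds α)) :
    ∃ d : LTSeries (PrimeSpectrum (MvPolynomial σ K)), d.length = c.length ∧
      ∀ i, vanishingIdeal K (Set.range v) ≤ (d i).asIdeal := by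
  have hp : ∀ Z : TopologicalSpace.IrreducibleCloseds α,
      (vanishingIdeal K (v '' (Z : Set α))).IsPrime := by
    intro Z
    have hZ := Z.isIrreducible
    refine ⟨?_, ?_⟩
    · intro h
      obtain ⟨x, hx⟩ := hZ.1
      have := (Ideal.eq_top_iff_one _).1 h (v x) ⟨x, hx, rfl⟩
      simp at this
    · intro f g hfg
      have key := isPreirreducible_iff_isClosed_union_isClosed.1 hZ.2
        (v ⁻¹' zeroLocus K (Ideal.span {f})) (v ⁻¹' zeroLocus K (Ideal.span {g}))
        ((ht _).2 ⟨_, rfl⟩) ((ht _).2 ⟨_, rfl⟩) (by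
          intro x hx
          have := hfg (v x) ⟨x, hx, rfl⟩
          rw [map_mul, mul_eq_zero] at this
          simpa [zeroLocus_span] using this)
      refine key.imp ?_ ?_ <;>
      · rintro h _ ⟨x, hx, rfl⟩
        simpa [zeroLocus_span] using h hx
  let F : (TopologicalSpace.IrreducibleCloseds α) → (PrimeSpectrum (MvPolynomial σ K))ᵒᵈ :=
    fun Z => OrderDual.toDual ⟨_, hp Z⟩
  have hF : StrictMono F := by
    intro Z W h
    refine lt_of_le_of_ne ?_ ?_
    · exact vanishingIdeal_anti_mono (Set.image_mono h.le)
    · intro he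
      have he' : vanishingIdeal K (v '' (Z : Set α)) = vanishingIdeal K (v '' (W : Set α)) :=
        congrArg PrimeSpectrum.asIdeal he
      apply h.not_ge
      obtain ⟨J, hJ⟩ := (ht _).1 Z.isClosed
      intro x hx
      change x ∈ (Z : Set α)
      rw [hJ]
      intro p hp
      have : p ∈ vanishingIdeal K (v '' (Z : Set α)) := by
        rintro _ ⟨y, hy, rfl⟩
        rw [hJ] at hy
        exact hy p hp
      rw [he'] at this
      exact this _ ⟨x, hx, rfl⟩
  refine ⟨(c.map F hF).reverse, rfl, ?_⟩
  intro i
  simp only [RelSeries.reverse]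
  exact vanishingIdeal_anti_mono (Set.image_subset_range _ _)

open MvPolynomial in
theorem zar_primes_to_chain {σ K α : Type*} [Field K] [t : TopologicalSpace α] (v : α → (σ → K))
    (ht : ∀ S : Set α, IsClosed S ↔ ∃ I : Ideal (MvPolynomial σ K), S = v ⁻¹' zeroLocus K I)
    (I0 : Ideal (MvPolynomial σ K)) (hv : Set.range v = zeroLocus K I0)
    (d : LTSeries (PrimeSpectrum (MvPolynomial σ K)))
    (hd : ∀ i, I0 ≤ (d i).asIdeal)
    (hr : ∀ i, vanishingIdeal K (zeroLocus K (d i).asIdeal) = (d i).asIdeal) :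
    (d.length : WithBot ℕ∞) ≤ topologicalKrullDim α := by
  have hlift : ∀ i, ∀ y ∈ zeroLocus K (d i).asIdeal, ∃ x, v x = y := by
    intro i y hy
    have := zeroLocus_anti_mono (hd i) hy
    rw [← hv] at this
    exact this
  have hirr : ∀ i, IsIrreducible (v ⁻¹' zeroLocus K (d i).asIdeal) := by
    intro i
    constructor
    · by_contra h
      rw [Set.not_nonempty_iff_eq_empty] at h
      have : zeroLocus K (d i).asIdeal = ∅ := by
        rw [Set.eq_empty_iff_forall_notMem]
        intro y hy
        obtain ⟨x, rfl⟩ := hlift i y hy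
        have : x ∈ v ⁻¹' zeroLocus K (d i).asIdeal := hy
        rw [h] at this
        exact this
      have h2 := hr i
      rw [this, vanishingIdeal_empty] at h2
      exact (d i).2.ne_top h2.symm
    · rw [isPreirreducible_iff_isClosed_union_isClosed]
      intro A B hA hB hAB
      obtain ⟨I, rfl⟩ := (ht _).1 hA
      obtain ⟨J, rfl⟩ := (ht _).1 hB
      have : I * J ≤ (d i).asIdeal := by
        rw [← hr i]
        rw [Ideal.mul_le]
        intro f hf g hg y hy
        obtain ⟨x, rfl⟩ := hlift i y hy
        rw [map_mul]
        rcases hAB hy with h | h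
        · rw [h f hf, zero_mul]
        · rw [h g hg, mul_zero]
      refine ((d i).2.mul_le.1 this).imp ?_ ?_ <;>
      · intro h
        exact Set.preimage_mono (zeroLocus_anti_mono h)
  let G : Fin (d.length + 1) → (TopologicalSpace.IrreducibleCloseds α)ᵒᵈ :=
    fun i => OrderDual.toDual ⟨v ⁻¹' zeroLocus K (d i).asIdeal, hirr i, (ht _).2 ⟨_, rfl⟩⟩
  have hG : StrictMono G := by
    intro i j hij
    have hlt : d i < d j := d.strictMono hij
    refine lt_of_le_of_ne ?_ ?_
    · have : v ⁻¹' zeroLocus K (d j).asIdeal ⊆ v ⁻¹' zeroLocus K (d i).asIdeal :=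
        Set.preimage_mono (zeroLocus_anti_mono hlt.le)
      exact this
    · intro he
      have he' : v ⁻¹' zeroLocus K (d i).asIdeal = v ⁻¹' zeroLocus K (d j).asIdeal :=
        congrArg TopologicalSpace.IrreducibleCloseds.carrier he
      apply hlt.not_ge
      change (d j).asIdeal ≤ (d i).asIdeal
      rw [← hr i]
      intro p hp y hy
      obtain ⟨x, rfl⟩ := hlift i y hy
      have : x ∈ v ⁻¹' zeroLocus K (d i).asIdeal := hy
      rw [he'] at this
      exact this p hp
  have := Order.LTSeries.length_le_krullDim (LTSeries.mk d.length G hG)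
  rw [Order.krullDim_orderDual] at this
  exact this
open MvPolynomial MeasureTheory in
theorem zar_image_measurable {n k : ℕ} (I : Ideal (MvPolynomial (Fin n) ℝ))
    (q : Fin k → MvPolynomial (Fin n) ℝ) :
    MeasurableSet ((fun x i => eval x (q i)) '' (zeroLocus ℝ I : Set (Fin n → ℝ))) := by
  have hc : IsClosed (zeroLocus ℝ I : Set (Fin n → ℝ)) := by
    have : (zeroLocus ℝ I : Set (Fin n → ℝ)) = ⋂ p ∈ I, {x | eval x p = 0} := by
      ext x; simp [aeval_eq_eval]
    rw [this]
    exact isClosed_biInter fun p _ => isClosed_eq (MvPolynomial.continuous_eval p) continuous_const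
  have hs : IsSigmaCompact (zeroLocus ℝ I : Set (Fin n → ℝ)) :=
    IsSigmaCompact.of_isClosed_subset isSigmaCompact_univ hc (Set.subset_univ _)
  have hs2 := hs.image (f := fun x (i : Fin k) => eval x (q i))
    (continuous_pi fun i => MvPolynomial.continuous_eval (q i))
  obtain ⟨K, hK, hKu⟩ := hs2
  rw [← hKu]
  exact MeasurableSet.iUnion fun i => (hK i).measurableSet

open MvPolynomial MeasureTheory in
theorem zar_maximal {n k : ℕ} (I0 : Ideal (MvPolynomial (Fin n) ℝ))
    (q : Fin k → MvPolynomial (Fin n) ℝ)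
    (hvol : volume ((fun x i => eval x (q i)) '' (zeroLocus ℝ I0 : Set (Fin n → ℝ))) ≠ 0) :
    ∃ I : Ideal (MvPolynomial (Fin n) ℝ), I0 ≤ I ∧ I.IsPrime ∧
      vanishingIdeal ℝ (zeroLocus ℝ I) = I ∧
      volume ((fun x i => eval x (q i)) '' (zeroLocus ℝ I : Set (Fin n → ℝ))) ≠ 0 := by
  have hVIV : ∀ I : Ideal (MvPolynomial (Fin n) ℝ),
      zeroLocus ℝ (vanishingIdeal ℝ (zeroLocus ℝ I)) = zeroLocus ℝ I := fun I =>
    le_antisymm (zeroLocus_anti_mono (le_vanishingIdeal_zeroLocus I)) (zeroLocus_vanishingIdeal_le _)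
  obtain ⟨I, ⟨h0, hcl, hI⟩, hmax⟩ := set_has_maximal_iff_noetherian.2
    (inferInstance : IsNoetherian (MvPolynomial (Fin n) ℝ) (MvPolynomial (Fin n) ℝ))
    {I : Ideal (MvPolynomial (Fin n) ℝ) | I0 ≤ I ∧ vanishingIdeal ℝ (zeroLocus ℝ I) = I ∧
      volume ((fun x i => eval x (q i)) '' (zeroLocus ℝ I : Set (Fin n → ℝ))) ≠ 0}
    ⟨vanishingIdeal ℝ (zeroLocus ℝ I0), le_vanishingIdeal_zeroLocus _, by rw [hVIV], by
      rwa [hVIV]⟩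
  have step : ∀ f : MvPolynomial (Fin n) ℝ, volume ((fun x i => eval x (q i)) ''
      (zeroLocus ℝ (I ⊔ Ideal.span {f}) : Set (Fin n → ℝ))) ≠ 0 → f ∈ I := by
    intro f hf
    by_contra hfI
    have hle := le_vanishingIdeal_zeroLocus (K := ℝ) (I ⊔ Ideal.span {f})
    refine hmax (vanishingIdeal ℝ (zeroLocus ℝ (I ⊔ Ideal.span {f})))
      ⟨h0.trans (le_sup_left.trans hle), by rw [hVIV], by rwa [hVIV]⟩ ?_
    refine lt_of_le_of_ne (le_sup_left.trans hle) ?_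
    intro he
    apply hfI
    rw [he]
    exact hle (Ideal.mem_sup_right (Ideal.mem_span_singleton_self f))
  refine ⟨I, h0, ⟨?_, ?_⟩, hcl, hI⟩
  · rintro rfl
    simp at hI
  · intro f g hfg
    by_contra hc
    rw [not_or] at hc
    have h1 := not_not.1 (mt (step f) hc.1)
    have h2 := not_not.1 (mt (step g) hc.2)
    apply hI
    refine measure_mono_null ?_ (measure_union_null h1 h2)
    rw [← Set.image_union]
    apply Set.image_mono
    intro x hx
    have := hx _ hfg
    rw [map_mul, mul_eq_zero] at this
    have key : ∀ f, aeval x f = 0 → x ∈ (zeroLocus ℝ (I ⊔ Ideal.span {f}) : Set (Fin n → ℝ)) := by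
      intro f hf
      rw [← Set.singleton_subset_iff]
      refine le_zeroLocus_iff_le_vanishingIdeal.2 (sup_le ?_ ?_)
      · rintro p hp _ rfl
        exact hx p hp
      · rw [Ideal.span_le]
        rintro _ rfl _ rfl
        exact hf
    exact this.imp (key f) (key g)

open MvPolynomial MeasureTheory in
theorem zar_measure_chain {n : ℕ} (k : ℕ) : ∀ (I0 : Ideal (MvPolynomial (Fin n) ℝ))
    (q : Fin k → MvPolynomial (Fin n) ℝ)
    (_ : volume ((fun x i => eval x (q i)) '' (zeroLocus ℝ I0 : Set (Fin n → ℝ))) ≠ 0),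
    ∃ d : Fin (k + 1) → PrimeSpectrum (MvPolynomial (Fin n) ℝ), StrictMono d ∧
      (∀ i, I0 ≤ (d i).asIdeal) ∧
      ∀ i, vanishingIdeal ℝ (zeroLocus ℝ (d i).asIdeal) = (d i).asIdeal := by
  induction k with
  | zero =>
    intro I0 q hvol
    obtain ⟨I, h0, hp, hcl, -⟩ := zar_maximal I0 q hvol
    refine ⟨fun _ => ⟨I, hp⟩, ?_, fun _ => h0, fun _ => hcl⟩
    intro i j hij
    exact absurd hij (by rw [Subsingleton.elim (α := Fin 1) i j]; exact lt_irrefl _)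
  | succ k ih =>
    intro I0 q hvol
    obtain ⟨I, h0, hp, hcl, hI⟩ := zar_maximal I0 q hvol
    set S := ((fun x i => eval x (q i)) '' (zeroLocus ℝ I : Set (Fin n → ℝ))) with hS
    have hSm : MeasurableSet S := zar_image_measurable I q
    have hslice : ∃ c : ℝ, volume {y : Fin k → ℝ | (Fin.cons c y : Fin (k + 1) → ℝ) ∈ S} ≠ 0 := by
      by_contra hc
      push Not at hc
      apply hI
      let e := MeasurableEquiv.piFinSuccAbove (fun _ : Fin (k + 1) => ℝ) 0
      have he : MeasurePreserving e := volume_preserving_piFinSuccAbove (fun _ => ℝ) 0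
      rw [← (he.symm e).measure_preimage_equiv S]
      refine Measure.measure_prod_null_of_ae_null (e.symm.measurable hSm) ?_
      refine Filter.Eventually.of_forall fun c => ?_
      have hset : Prod.mk c ⁻¹' (e.symm ⁻¹' S) =
          {y : Fin k → ℝ | (Fin.cons c y : Fin (k + 1) → ℝ) ∈ S} := by
        ext y
        have : e.symm (c, y) = (Fin.cons c y : Fin (k + 1) → ℝ) := by
          simp [e, MeasurableEquiv.piFinSuccAbove]
          rfl
        simp only [Set.mem_preimage, Set.mem_ofPred_eq, this]
      change volume (Prod.mk c ⁻¹' (e.symm ⁻¹' S)) = 0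
      rw [hset]
      exact hc c
    obtain ⟨c, hc⟩ := hslice
    obtain ⟨d, hd, hdI, hdr⟩ := ih (I ⊔ Ideal.span {q 0 - C c}) (fun i => q i.succ) (by
      intro hz
      apply hc
      refine measure_mono_null ?_ hz
      rintro y ⟨x, hx, hxy⟩
      refine ⟨x, ?_, ?_⟩
      · rw [← Set.singleton_subset_iff]
        refine le_zeroLocus_iff_le_vanishingIdeal.2 (sup_le ?_ ?_)
        · rintro p hp _ rfl
          exact hx p hp
        · rw [Ideal.span_le]
          rintro _ rfl _ rfl
          have := congrFun hxy 0
          simp only [Fin.cons_zero] at this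
          simp [aeval_eq_eval, this]
      · funext i
        have := congrFun hxy i.succ
        simpa using this)
    refine ⟨Fin.cons ⟨I, hp⟩ d, ?_, ?_, ?_⟩
    · refine StrictMono.vecCons hd ?_
      refine lt_of_le_of_ne (le_sup_left.trans (hdI 0)) ?_
      intro he
      have he' : I = (d 0).asIdeal := congrArg PrimeSpectrum.asIdeal he
      have hq : q 0 - C c ∈ I := by
        rw [he']
        exact hdI 0 (Ideal.mem_sup_right (Ideal.mem_span_singleton_self _))
      apply hI
      refine measure_mono_null ?_ (Measure.pi_hyperplane (fun _ : Fin (k + 1) => volume) 0 c)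
      rintro _ ⟨x, hx, rfl⟩
      have := hx _ hq
      simpa [aeval_eq_eval, sub_eq_zero] using this
    · intro i
      refine Fin.cases h0 (fun j => ?_) i
      exact h0.trans (le_sup_left.trans (hdI j))
    · intro i
      refine Fin.cases hcl (fun j => ?_) i
      exact hdr j
theorem zar_root_nhds {s : ℕ} (F : Polynomial (MvPolynomial (Fin s) ℝ)) (b0 : Fin s → ℝ) (t0 : ℝ)
    (h0 : F.eval₂ (MvPolynomial.eval b0) t0 = 0)
    (h1 : F.derivative.eval₂ (MvPolynomial.eval b0) t0 ≠ 0) :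
    ∀ᶠ b in nhds b0, ∃ t : ℝ, F.eval₂ (MvPolynomial.eval b) t = 0 := by
  have hcont : ∀ t : ℝ, Continuous fun b : Fin s → ℝ => F.eval₂ (MvPolynomial.eval b) t := by
    intro t
    simp only [Polynomial.eval₂_eq_sum_range]
    exact continuous_finsetSum _ fun i _ =>
      (MvPolynomial.continuous_eval _).mul continuous_const
  set f := F.map (MvPolynomial.eval b0) with hf
  have hf0 : f.eval t0 = 0 := by rw [hf, Polynomial.eval_map]; exact h0
  have hf1 : f.derivative.eval t0 ≠ 0 := by
    rw [hf, Polynomial.derivative_map, Polynomial.eval_map]; exact h1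
  obtain ⟨g, hg⟩ := Polynomial.dvd_iff_isRoot.2 hf0
  have hg0 : g.eval t0 ≠ 0 := by
    intro h
    apply hf1
    rw [hg]
    simp [h]
  have hgc : ∀ᶠ t in nhds t0, 0 < g.eval t * g.eval t0 := by
    have : Continuous fun t => g.eval t * g.eval t0 := g.continuous.mul continuous_const
    exact this.continuousAt.eventually (lt_mem_nhds (mul_self_pos.2 hg0))
  obtain ⟨ε, hε, hball⟩ := Metric.eventually_nhds_iff.1 hgc
  have ha := hball (y := t0 - ε / 2) (by rw [Real.dist_eq]; simp only [sub_sub_cancel_left, add_sub_cancel_left, abs_neg, abs_of_pos (half_pos hε)]; linarith)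
  have hb := hball (y := t0 + ε / 2) (by rw [Real.dist_eq]; simp only [sub_sub_cancel_left, add_sub_cancel_left, abs_neg, abs_of_pos (half_pos hε)]; linarith)
  have hneg : f.eval (t0 - ε / 2) * f.eval (t0 + ε / 2) < 0 := by
    rw [hg]
    simp only [Polynomial.eval_mul, Polynomial.eval_sub, Polynomial.eval_X, Polynomial.eval_C]
    have h3 : 0 < g.eval (t0 - ε / 2) * g.eval (t0 + ε / 2) := by
      have := mul_pos ha hb
      have h4 : 0 < g.eval t0 * g.eval t0 := mul_self_pos.2 hg0
      by_contra hc
      push Not at hc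
      nlinarith
    nlinarith [mul_pos h3 (mul_pos hε hε)]
  rw [hf, Polynomial.eval_map, Polynomial.eval_map] at hneg
  have hev := ((hcont (t0 - ε / 2)).mul (hcont (t0 + ε / 2))).continuousAt.eventually
    (gt_mem_nhds hneg)
  filter_upwards [hev] with b hb
  have hc2 : Continuous fun t => F.eval₂ (MvPolynomial.eval b) t := by
    simp only [← Polynomial.eval_map]
    exact (F.map (MvPolynomial.eval b)).continuous
  have hivt := intermediate_value_uIcc (a := t0 - ε / 2) (b := t0 + ε / 2) hc2.continuousOn
  have h0m : (0 : ℝ) ∈ Set.uIcc (F.eval₂ (MvPolynomial.eval b) (t0 - ε / 2))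
      (F.eval₂ (MvPolynomial.eval b) (t0 + ε / 2)) := by
    rw [Set.mem_uIcc]
    rcases mul_neg_iff.1 hb with h | h
    · right; exact ⟨h.2.le, h.1.le⟩
    · left; exact ⟨h.1.le, h.2.le⟩
  obtain ⟨t, -, ht⟩ := hivt h0m
  exact ⟨t, ht⟩

theorem zar_extend_hom {B A k : Type*} [CommRing B] [CommRing A] [Field k] [Algebra B A]
    (θ : A) (F : Polynomial B) (h : B)
    (hF : ∀ G : Polynomial B, Polynomial.aeval θ G = 0 → F ∣ G)
    (hh : ∀ a : A, ∃ G : Polynomial B, algebraMap B A h * a = Polynomial.aeval θ G)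
    (φ : B →+* k) (t : k) (ht : F.eval₂ φ t = 0) (hφ : φ h ≠ 0) :
    ∃ ψ : A →+* k, ∀ b, ψ (algebraMap B A b) = φ b := by
  have key : ∀ G G' : Polynomial B, Polynomial.aeval θ G = Polynomial.aeval θ G' →
      G.eval₂ φ t = G'.eval₂ φ t := by
    intro G G' he
    obtain ⟨H, hH⟩ := hF (G - G') (by rw [map_sub, he, sub_self])
    rw [← sub_eq_zero, ← Polynomial.eval₂_sub, hH, Polynomial.eval₂_mul, ht, zero_mul]
  choose G hG using hh
  have val : ∀ (a : A) (P : Polynomial B), algebraMap B A h * a = Polynomial.aeval θ P →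
      (G a).eval₂ φ t = P.eval₂ φ t := fun a P hP => key _ _ ((hG a).symm.trans hP)
  have hb : ∀ b, (G (algebraMap B A b)).eval₂ φ t / φ h = φ b := by
    intro b
    rw [val (algebraMap B A b) (Polynomial.C (h * b)) (by simp)]
    simp [hφ]
  refine ⟨
    { toFun := fun a => (G a).eval₂ φ t / φ h
      map_one' := by simpa using hb 1
      map_zero' := by simpa using hb 0
      map_add' := ?_
      map_mul' := ?_ }, hb⟩
  · intro x y
    have h1 := key (Polynomial.C h * G (x * y)) (G x * G y) (by
      rw [map_mul, map_mul, ← hG, ← hG, ← hG, Polynomial.aeval_C]; ring)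
    simp only [Polynomial.eval₂_mul, Polynomial.eval₂_C] at h1
    change (G (x * y)).eval₂ φ t / φ h = (G x).eval₂ φ t / φ h * ((G y).eval₂ φ t / φ h)
    field_simp
    linear_combination h1
  · intro x y
    change (G (x + y)).eval₂ φ t / φ h = (G x).eval₂ φ t / φ h + ((G y).eval₂ φ t / φ h)
    rw [val (x + y) (G x + G y) (by rw [map_add, ← hG, ← hG]; ring), Polynomial.eval₂_add, add_div]

theorem zar_primitive (B A : Type*) [CommRing B] [CommRing A] [IsDomain B] [IsDomain A]
    [IsIntegrallyClosed B] [CharZero B] [Algebra B A] [Module.Finite B A]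
    (hinj : Function.Injective (algebraMap B A)) :
    ∃ (θ : A) (F : Polynomial B) (h : B), h ≠ 0 ∧ Polynomial.aeval θ F = 0 ∧
      Polynomial.aeval θ F.derivative ≠ 0 ∧
      (∀ G : Polynomial B, Polynomial.aeval θ G = 0 → F ∣ G) ∧
      (∀ a : A, ∃ G : Polynomial B, algebraMap B A h * a = Polynomial.aeval θ G) := by
  have : FaithfulSMul B A := (faithfulSMul_iff_algebraMap_injective B A).2 hinj
  have : Module.IsTorsionFree B A := inferInstance
  let K := FractionRing B
  let L := FractionRing A
  let : Algebra K L := FractionRing.liftAlgebra B L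
  have : IsScalarTower B K L := inferInstance
  have : Module.Finite K L := Module.Finite.of_isLocalization B A (nonZeroDivisors B)
  have : CharZero K := inferInstance
  obtain ⟨α, hα⟩ := Field.exists_primitive_element K L
  have hAL : Function.Injective (algebraMap A L) := IsFractionRing.injective A L
  -- scale the primitive element into A
  obtain ⟨θ, hθ⟩ : ∃ θ : A, IntermediateField.adjoin K {algebraMap A L θ} = ⊤ := by
    obtain ⟨⟨a, s⟩, hs⟩ := IsLocalization.surj
      (Algebra.algebraMapSubmonoid A (nonZeroDivisors B)) α
    obtain ⟨s, b, hb, rfl⟩ := s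
    simp only at hs
    have hb0 : b ≠ 0 := nonZeroDivisors.ne_zero hb
    refine ⟨a, ?_⟩
    rw [eq_top_iff, ← hα, IntermediateField.adjoin_simple_le_iff]
    have hbK : algebraMap B K b ≠ 0 := by
      rwa [Ne, FaithfulSMul.algebraMap_eq_zero_iff]
    have hbL : algebraMap A L (algebraMap B A b) = algebraMap K L (algebraMap B K b) := by
      rw [← IsScalarTower.algebraMap_apply B A L, ← IsScalarTower.algebraMap_apply B K L]
    have hα' : α = algebraMap A L a * algebraMap K L (algebraMap B K b)⁻¹ := by
      rw [← hs, hbL, mul_assoc, ← map_mul, mul_inv_cancel₀ hbK, map_one, mul_one]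
    rw [hα']
    exact mul_mem (IntermediateField.mem_adjoin_simple_self K _)
      (IntermediateField.algebraMap_mem _ _)
  have hint : IsIntegral B θ := Algebra.IsIntegral.isIntegral θ
  -- each element of A
  have hone : ∀ a : A, ∃ h : B, h ≠ 0 ∧ ∃ G : Polynomial B,
      algebraMap B A h * a = Polynomial.aeval θ G := by
    intro a
    have ha : algebraMap A L a ∈
        (IntermediateField.adjoin K {algebraMap A L θ}).toSubalgebra := by
      rw [hθ]; trivial
    rw [IntermediateField.adjoin_simple_toSubalgebra_of_isAlgebraic (IsAlgebraic.of_finite K _),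
      Algebra.adjoin_singleton_eq_range_aeval] at ha
    obtain ⟨p, hp⟩ := ha
    obtain ⟨h, hh, hG⟩ := IsLocalization.integerNormalization_spec (nonZeroDivisors B) p
    refine ⟨h, nonZeroDivisors.ne_zero hh,
      IsLocalization.integerNormalization (nonZeroDivisors B) p, hAL ?_⟩
    rw [map_mul, ← Polynomial.aeval_algebraMap_apply,
      ← Polynomial.aeval_map_algebraMap K, hG]
    have hp' : Polynomial.aeval (algebraMap A L θ) p = algebraMap A L a := hp
    rw [← hp', ← IsScalarTower.algebraMap_apply B A L]
    change _ = Polynomial.aeval _ (h • p)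
    rw [AlgHom.map_smul_of_tower, Algebra.smul_def]
  obtain ⟨S, hS⟩ := (Module.Finite.fg_top : (⊤ : Submodule B A).FG)
  choose h hh0 G hG using hone
  refine ⟨θ, minpoly B θ, ∏ a ∈ S, h a, Finset.prod_ne_zero_iff.2 fun a _ => hh0 a,
    minpoly.aeval B θ, ?_, fun G hG => minpoly.isIntegrallyClosed_dvd hint hG, ?_⟩
  · intro h0
    have hsep : (minpoly K (algebraMap A L θ)).Separable :=
      Algebra.IsSeparable.isSeparable K (algebraMap A L θ)
    apply hsep.aeval_derivative_ne_zero (minpoly.aeval K (algebraMap A L θ))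
    rw [minpoly.isIntegrallyClosed_eq_field_fractions K L hint, Polynomial.derivative_map,
      Polynomial.aeval_map_algebraMap, Polynomial.aeval_algebraMap_apply, h0, map_zero]
  · intro a
    have ha : a ∈ Submodule.span B (S : Set A) := by rw [hS]; trivial
    induction ha using Submodule.span_induction with
    | mem x hx =>
      classical
      obtain ⟨c, hc⟩ := Finset.dvd_prod_of_mem h hx
      refine ⟨Polynomial.C c * G x, ?_⟩
      rw [hc, map_mul, map_mul, Polynomial.aeval_C, ← hG]
      ring
    | zero => exact ⟨0, by simp⟩
    | add x y _ _ hx hy =>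
      obtain ⟨P, hP⟩ := hx
      obtain ⟨Q, hQ⟩ := hy
      exact ⟨P + Q, by rw [mul_add, hP, hQ, map_add]⟩
    | smul b x _ hx =>
      obtain ⟨P, hP⟩ := hx
      exact ⟨b • P, by rw [mul_smul_comm, hP, map_smul]⟩

open MvPolynomial MeasureTheory in
theorem zar_posvol {n s : ℕ} (I : Ideal (MvPolynomial (Fin n) ℝ))
    (hcl : vanishingIdeal ℝ (zeroLocus ℝ I) = I)
    {A : Type*} [CommRing A] [IsDomain A] [Algebra ℝ A]
    (mk : MvPolynomial (Fin n) ℝ →ₐ[ℝ] A) (hmk : Function.Surjective mk)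
    (hker : ∀ p, mk p = 0 ↔ p ∈ I)
    (g : MvPolynomial (Fin s) ℝ →ₐ[ℝ] A)
    (hg : Function.Injective g) (hfin : g.Finite) :
    ∃ q : Fin s → MvPolynomial (Fin n) ℝ,
      volume ((fun x i => eval x (q i)) '' (zeroLocus ℝ I : Set (Fin n → ℝ))) ≠ 0 := by
  let : Algebra (MvPolynomial (Fin s) ℝ) A := g.toRingHom.toAlgebra
  have halg : ∀ b, algebraMap (MvPolynomial (Fin s) ℝ) A b = g b :=
    fun b => rfl
  have : Module.Finite (MvPolynomial (Fin s) ℝ) A := hfin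
  obtain ⟨θ, F, h, hh0, hFθ, hF'θ, hFdvd, hhA⟩ :=
    zar_primitive (MvPolynomial (Fin s) ℝ) A hg
  choose q hq using fun i : Fin s => hmk (g (X i))
  refine ⟨q, ?_⟩
  -- a good point
  obtain ⟨w, hw⟩ := hmk
    (Polynomial.aeval θ F.derivative * g h)
  have hw0 : w ∉ I := by
    intro hwI
    rw [(hker w).2 hwI] at hw
    rcases mul_eq_zero.1 hw.symm with h1 | h1
    · exact hF'θ h1
    · exact hh0 (hg (h1.trans (map_zero g).symm))
  rw [← hcl] at hw0
  simp only [mem_vanishingIdeal_iff, not_forall] at hw0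
  obtain ⟨x, hx, hxw⟩ := hw0
  let ev : A →ₐ[ℝ] ℝ := AlgHom.liftOfSurjective mk hmk (aeval x)
    (fun p hp => hx p ((hker p).1 hp))
  have hev : ∀ p, ev (mk p) = aeval x p := fun p =>
    AlgHom.liftOfSurjective_apply ..
  let b0 : Fin s → ℝ := fun i => ev (g (X i))
  have hb0 : ∀ b, ev (g b) = eval b0 b := by
    intro b
    have : ev.comp g = aeval b0 := by
      apply MvPolynomial.algHom_ext
      intro i
      simp [b0]
    have h2 := DFunLike.congr_fun this b
    simpa [aeval_eq_eval] using h2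
  have heval : ∀ G : Polynomial (MvPolynomial (Fin s) ℝ),
      ev (Polynomial.aeval θ G) = G.eval₂ (eval b0) (ev θ) := by
    intro G
    rw [Polynomial.aeval_def]
    change ev.toRingHom _ = _
    rw [Polynomial.hom_eval₂]
    congr 1
    ext b
    · simp [halg, hb0]
    · simp [halg, hb0]
  have hxw' : ev (Polynomial.aeval θ F.derivative) * ev (g h) ≠ 0 := by
    rw [← map_mul, ← hw, hev]; exact hxw
  have hnear := zar_root_nhds F b0 (ev θ) (by rw [← heval, hFθ, map_zero])
    (by rw [← heval]; exact left_ne_zero_of_mul hxw')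
  have hnear2 : ∀ᶠ b in nhds b0, eval b h ≠ 0 := by
    refine (MvPolynomial.continuous_eval h).continuousAt.eventually_ne ?_
    rw [← hb0]; exact right_ne_zero_of_mul hxw'
  have hmem : ((fun x i => eval x (q i)) '' (zeroLocus ℝ I : Set (Fin n → ℝ))) ∈ nhds b0 := by
    filter_upwards [hnear, hnear2] with b hb hbh
    obtain ⟨t, ht⟩ := hb
    obtain ⟨ψ, hψ⟩ := zar_extend_hom θ F h hFdvd hhA (eval b) t ht hbh
    let y : Fin n → ℝ := fun j => ψ (mk (X j))
    have hy : ∀ p, eval y p = ψ (mk p) := by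
      intro p
      have : eval y = ψ.comp mk.toRingHom := by
        apply MvPolynomial.ringHom_ext
        · intro r
          have h1 := hψ (C r)
          rw [halg, ← MvPolynomial.algebraMap_eq, AlgHom.commutes, MvPolynomial.algebraMap_eq,
            eval_C] at h1
          rw [eval_C]
          change r = ψ (mk (C r))
          rw [← MvPolynomial.algebraMap_eq, AlgHom.commutes]
          exact h1.symm
        · intro j
          simp [y]
      rw [this]
      rfl
    refine ⟨y, ?_, ?_⟩
    · intro p hp
      rw [aeval_eq_eval]
      change eval y p = 0
      rw [hy, (hker p).2 hp, map_zero]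
    · funext i
      change eval y (q i) = b i
      rw [hy, hq, ← halg, hψ, eval_X]
  exact (Measure.measure_pos_of_mem_nhds volume hmem).ne'

theorem zar_integral_dim {R S : Type*} [CommRing R] [CommRing S] (f : R →+* S)
    (hf : f.IsIntegral) : StrictMono (PrimeSpectrum.comap f) := by
  intro P Q h
  let := f.toAlgebra
  obtain ⟨hle, x, hx, hx'⟩ := SetLike.lt_iff_le_and_exists.1 (show P.asIdeal < Q.asIdeal from h)
  exact Ideal.comap_lt_comap_of_integral_mem_sdiff (R := R) hle ⟨hx, hx'⟩ (hf x)

open MvPolynomial in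
theorem zar_real_main {n : ℕ} (I0 : Ideal (MvPolynomial (Fin n) ℝ))
    (c : LTSeries (PrimeSpectrum (MvPolynomial (Fin n) ℝ)))
    (hc : ∀ i, vanishingIdeal ℝ (zeroLocus ℝ I0) ≤ (c i).asIdeal) :
    ∃ d : LTSeries (PrimeSpectrum (MvPolynomial (Fin n) ℝ)), c.length ≤ d.length ∧
      (∀ i, I0 ≤ (d i).asIdeal) ∧
      ∀ i, vanishingIdeal ℝ (zeroLocus ℝ (d i).asIdeal) = (d i).asIdeal := by
  have hVIV : ∀ I : Ideal (MvPolynomial (Fin n) ℝ),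
      zeroLocus ℝ (vanishingIdeal ℝ (zeroLocus ℝ I)) = zeroLocus ℝ I := fun I =>
    le_antisymm (zeroLocus_anti_mono (le_vanishingIdeal_zeroLocus I)) (zeroLocus_vanishingIdeal_le _)
  obtain ⟨(I : Ideal (MvPolynomial (Fin n) ℝ)), ⟨h0, hcl, hIc⟩, hmax⟩ :=
    set_has_maximal_iff_noetherian.2
    (inferInstance : IsNoetherian (MvPolynomial (Fin n) ℝ) (MvPolynomial (Fin n) ℝ))
    {I : Ideal (MvPolynomial (Fin n) ℝ) | I0 ≤ I ∧ vanishingIdeal ℝ (zeroLocus ℝ I) = I ∧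
      I ≤ (c 0).asIdeal}
    ⟨vanishingIdeal ℝ (zeroLocus ℝ I0), le_vanishingIdeal_zeroLocus _, by rw [hVIV], hc 0⟩
  have step : ∀ f : MvPolynomial (Fin n) ℝ,
      vanishingIdeal ℝ (zeroLocus ℝ (I ⊔ Ideal.span {f})) ≤ (c 0).asIdeal → f ∈ I := by
    intro f hf
    by_contra hfI
    have hle := le_vanishingIdeal_zeroLocus (K := ℝ) (I ⊔ Ideal.span {f})
    refine hmax (vanishingIdeal ℝ (zeroLocus ℝ (I ⊔ Ideal.span {f})))
      ⟨h0.trans (le_sup_left.trans hle), by rw [hVIV], hf⟩ ?_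
    refine lt_of_le_of_ne (le_sup_left.trans hle) ?_
    intro he
    apply hfI
    rw [he]
    exact hle (Ideal.mem_sup_right (Ideal.mem_span_singleton_self f))
  have hp : Ideal.IsPrime I := by
    refine ⟨fun h => (c 0).2.ne_top (top_le_iff.1 (h.symm.le.trans hIc)), ?_⟩
    intro f g hfg
    have hmul : vanishingIdeal ℝ (zeroLocus ℝ (I ⊔ Ideal.span {f})) *
        vanishingIdeal ℝ (zeroLocus ℝ (I ⊔ Ideal.span {g})) ≤ (c 0).asIdeal := by
      refine le_trans ?_ hIc
      rw [Ideal.mul_le]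
      intro u hu v hv
      rw [← hcl]
      intro x hx
      have := hx _ hfg
      rw [map_mul, mul_eq_zero] at this
      have key : ∀ f, aeval x f = 0 →
          x ∈ (zeroLocus ℝ (I ⊔ Ideal.span {f}) : Set (Fin n → ℝ)) := by
        intro f hf
        rw [← Set.singleton_subset_iff]
        refine le_zeroLocus_iff_le_vanishingIdeal.2 (sup_le ?_ ?_)
        · rintro p hp _ rfl
          exact hx p hp
        · rw [Ideal.span_le]
          rintro _ rfl _ rfl
          exact hf
      rw [map_mul]
      rcases this with h | h
      · rw [hu x (key f h), zero_mul]
      · rw [hv x (key g h), mul_zero]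
    exact ((c 0).2.mul_le.1 hmul).imp (step f) (step g)
  obtain ⟨s, g, hg, hfin⟩ := exists_finite_inj_algHom_of_fg ℝ (MvPolynomial (Fin n) ℝ ⧸ I)
  obtain ⟨q, hq⟩ := zar_posvol I hcl (Ideal.Quotient.mkₐ ℝ I)
    (Ideal.Quotient.mkₐ_surjective ℝ I) (fun p => Ideal.Quotient.eq_zero_iff_mem) g hg hfin
  obtain ⟨d, hd, hdI, hdr⟩ := zar_measure_chain s I q hq
  refine ⟨LTSeries.mk s d hd, ?_, fun i => h0.trans (hdI i), hdr⟩
  change c.length ≤ s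
  have h1 : ringKrullDim (MvPolynomial (Fin n) ℝ ⧸ I) ≤ ringKrullDim (MvPolynomial (Fin s) ℝ) :=
    Order.krullDim_le_of_strictMono _ (zar_integral_dim g.toRingHom hfin.to_isIntegral)
  rw [MvPolynomial.ringKrullDim_of_isNoetherianRing, ringKrullDim_eq_zero_of_field, zero_add,
    Nat.card_eq_fintype_card, Fintype.card_fin, ringKrullDim_quotient] at h1
  let c' : LTSeries (PrimeSpectrum.zeroLocus (I : Set (MvPolynomial (Fin n) ℝ))) :=
    LTSeries.mk c.length
      (fun i => ⟨c i, hIc.trans (show c 0 ≤ c i from c.strictMono.monotone (Fin.zero_le i))⟩)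
      (fun i j hij => c.strictMono hij)
  have h2 := (Order.LTSeries.length_le_krullDim c').trans h1
  exact_mod_cast h2

open MvPolynomial in
theorem zar_eval_real {n : ℕ} (x : Fin n → ℝ) (q : MvPolynomial (Fin n) ℝ) :
    eval (fun i => (x i : ℂ)) (map Complex.ofRealHom q) = ((eval x q : ℝ) : ℂ) := by
  induction q using MvPolynomial.induction_on with
  | C a => simp
  | add p q hp hq => simp [hp, hq]
  | mul_X p i hp => simp [hp]

open MvPolynomial in
theorem zar_reim {n : ℕ} (p : MvPolynomial (Fin n) ℂ) :
    ∃ q r : MvPolynomial (Fin n) ℝ, ∀ x : Fin n → ℝ,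
      eval (fun i => (x i : ℂ)) p = ((eval x q : ℝ) : ℂ) + ((eval x r : ℝ) : ℂ) * Complex.I := by
  induction p using MvPolynomial.induction_on with
  | C a => exact ⟨C a.re, C a.im, fun x => by simp⟩
  | add p p' hp hp' =>
    obtain ⟨q, r, h⟩ := hp
    obtain ⟨q', r', h'⟩ := hp'
    refine ⟨q + q', r + r', fun x => ?_⟩
    simp only [map_add, h, h']
    push_cast
    ring
  | mul_X p i hp =>
    obtain ⟨q, r, h⟩ := hp
    refine ⟨q * X i, r * X i, fun x => ?_⟩
    simp only [map_mul, h, eval_X]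
    push_cast
    ring

open MvPolynomial in
theorem zar_real_eq_induced (n : ℕ) :
    zariskiTopology (Fin n) ℝ = TopologicalSpace.induced
      (fun (x : Fin n → ℝ) (i : Fin n) => (x i : ℂ)) (zariskiTopology (Fin n) ℂ) := by
  apply le_antisymm
  · rw [← continuous_iff_le_induced, zariskiTopology, zariskiTopology,
      continuous_generateFrom_iff]
    rintro _ ⟨p, rfl⟩
    obtain ⟨q, r, h⟩ := zar_reim p
    have : (fun (x : Fin n → ℝ) (i : Fin n) => (x i : ℂ)) ⁻¹' {x | eval x p ≠ 0} =
        {x | eval x q ≠ 0} ∪ {x | eval x r ≠ 0} := by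
      ext x
      have h2 : eval (fun i => (x i : ℂ)) p = 0 ↔ eval x q = 0 ∧ eval x r = 0 := by
        rw [h, Complex.ext_iff]
        simp
      change ¬ (eval (fun i => (x i : ℂ)) p = 0) ↔ (¬ (eval x q = 0) ∨ ¬ (eval x r = 0))
      rw [h2]
      tauto
    rw [this]
    refine @IsOpen.union _ _ _ (_) ?_ ?_
    · exact TopologicalSpace.isOpen_generateFrom_of_mem ⟨q, rfl⟩
    · exact TopologicalSpace.isOpen_generateFrom_of_mem ⟨r, rfl⟩
  · conv_rhs => rw [zariskiTopology]
    refine le_generateFrom ?_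
    rintro _ ⟨q, rfl⟩
    refine ⟨{x | eval x (map Complex.ofRealHom q) ≠ 0},
      TopologicalSpace.isOpen_generateFrom_of_mem ⟨_, rfl⟩, ?_⟩
    ext x
    change ¬ (eval (fun i => (x i : ℂ)) (map Complex.ofRealHom q) = 0) ↔ ¬ (eval x q = 0)
    rw [zar_eval_real, Complex.ofReal_eq_zero]

open MvPolynomial in
theorem zar_map_integral (n : ℕ) :
    (map Complex.ofRealHom : MvPolynomial (Fin n) ℝ →+* MvPolynomial (Fin n) ℂ).IsIntegral := by
  intro p
  induction p using MvPolynomial.induction_on with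
  | C a =>
    have h : (Complex.ofRealHom).IsIntegralElem a := Algebra.IsIntegral.isIntegral (R := ℝ) a
    obtain ⟨f, hf, hfa⟩ := h
    refine ⟨f.map C, hf.map _, ?_⟩
    rw [Polynomial.eval₂_map]
    have : (map Complex.ofRealHom : MvPolynomial (Fin n) ℝ →+* MvPolynomial (Fin n) ℂ).comp C =
        C.comp Complex.ofRealHom := by
      ext r <;> simp
    rw [this, ← Polynomial.hom_eval₂, hfa, map_zero]
  | add p q hp hq => exact hp.add _ hq
  | mul_X p i hp =>
    refine hp.mul _ ?_
    have := RingHom.isIntegralElem_map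
      (map Complex.ofRealHom : MvPolynomial (Fin n) ℝ →+* MvPolynomial (Fin n) ℂ) (x := X i)
    rwa [map_X] at this

/-- If a Zariski-closed `X ⊆ ℂ^n` is defined over the reals
(i.e. `X` is the complex Zariski closure of its real part `X ∩ ℝ^n`, viewed
inside `ℂ^n`), then `X` is observable over the reals: the Krull dimension of
`X ∩ ℝ^n` in the real Zariski topology equals the Krull dimension of `X` in the
complex Zariski topology. -/
theorem stmt_9 (n : ℕ) (X : Set (Fin n → ℂ))
    (hX : ∃ T : Set (MvPolynomial (Fin n) ℂ),
      X = {x | ∀ p ∈ T, MvPolynomial.eval x p = 0})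
    (hdef : X = @closure _ (zariskiTopology (Fin n) ℂ)
      (X ∩ {y : Fin n → ℂ | ∀ i, ∃ t : ℝ, y i = (t : ℂ)})) :
    @topologicalKrullDim {x : Fin n → ℝ // (fun i => (x i : ℂ)) ∈ X}
        (TopologicalSpace.induced Subtype.val (zariskiTopology (Fin n) ℝ))
      = @topologicalKrullDim X
        (TopologicalSpace.induced Subtype.val (zariskiTopology (Fin n) ℂ)) := by
  apply le_antisymm
  · refine @Topology.IsInducing.topologicalKrullDim_le _ _
      (TopologicalSpace.induced Subtype.val (zariskiTopology (Fin n) ℂ))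
      (TopologicalSpace.induced Subtype.val (zariskiTopology (Fin n) ℝ))
      (fun x => ⟨fun i => (x.1 i : ℂ), x.2⟩) (@Topology.IsInducing.mk _ _ (_) (_) _ ?_)
    rw [zar_real_eq_induced, induced_compose, induced_compose]
    rfl
  · have hXcl : @IsClosed _ (zariskiTopology (Fin n) ℂ) X := by
      rw [hdef]
      exact @isClosed_closure _ (zariskiTopology (Fin n) ℂ) _
    have hYcl : @IsClosed _ (zariskiTopology (Fin n) ℝ)
        {x : Fin n → ℝ | (fun i => (x i : ℂ)) ∈ X} := by
      rw [zar_real_eq_induced]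
      exact (@isClosed_induced_iff _ _ (zariskiTopology (Fin n) ℂ) _ _).2 ⟨X, hXcl, rfl⟩
    obtain ⟨I0, hI0⟩ := (zar_isClosed_iff _).1 hYcl
    unfold topologicalKrullDim
    refine iSup_le fun c => ?_
    obtain ⟨d, hdl, hd⟩ := @zar_chain_to_primes (Fin n) ℂ X _
      (TopologicalSpace.induced Subtype.val (zariskiTopology (Fin n) ℂ)) Subtype.val
      (zar_isClosed_induced_iff _) c
    obtain ⟨e, hel, heI, her⟩ := zar_real_main I0 (d.map _ (zar_integral_dim _ (zar_map_integral n)))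
      (by
        intro i f hf
        refine hd i ?_
        rintro _ ⟨x, rfl⟩
        have hsub : X ⊆ MvPolynomial.zeroLocus ℂ
            (Ideal.span {MvPolynomial.map Complex.ofRealHom f}) := by
          rw [hdef]
          refine @closure_minimal _ (zariskiTopology (Fin n) ℂ) _ _ ?_
            ((zar_isClosed_iff _).2 ⟨_, rfl⟩)
          rintro y ⟨hyX, hy⟩
          choose t ht using hy
          obtain rfl : y = fun i => (t i : ℂ) := funext ht
          rw [MvPolynomial.zeroLocus_span]
          rintro _ rfl
          have h0 : MvPolynomial.aeval t f = 0 := hf t (by rw [← hI0]; exact hyX)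
          rw [MvPolynomial.aeval_eq_eval] at h0 ⊢
          change MvPolynomial.eval (fun i => (t i : ℂ)) _ = 0
          change MvPolynomial.eval t f = 0 at h0
          rw [zar_eval_real, h0, Complex.ofReal_zero]
        exact hsub x.2 _ (Ideal.mem_span_singleton_self _))
    have hfin := @zar_primes_to_chain (Fin n) ℝ {x : Fin n → ℝ // (fun i => (x i : ℂ)) ∈ X} _
      (TopologicalSpace.induced Subtype.val (zariskiTopology (Fin n) ℝ)) Subtype.val
      (zar_isClosed_induced_iff _) I0 (by rw [← hI0]; exact Subtype.range_val) e heI her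
    refine le_trans ?_ hfin
    have : c.length ≤ e.length := by
      rw [← hdl]; exact hel
    exact_mod_cast this
end

section
/- Let X ⊆ ℂ^n be a Zariski-closed set that is irreducible (in the complex Zariski topology) and observable over the reals, i.e., the Krull dimension of X_ℝ := X ∩ ℝ^n in the real Zariski topology equals the Krull dimension of X in the complex Zariski topology. Then X is defined over the reals: X equals the complex Zariski closure of X_ℝ. -/
open TopologicalSpace Topology in
theorem denseRange_of_dim_eq {A B : Type*} [TopologicalSpace A] [TopologicalSpace B]
    (f : A → B) (hf : IsInducing f) [IrreducibleSpace B]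
    (hd : topologicalKrullDim A = topologicalKrullDim B) (ht : topologicalKrullDim B ≠ ⊤) :
    closure (Set.range f) = Set.univ := by
  by_contra hne
  have hBne : Nonempty (IrreducibleCloseds B) :=
    ⟨⟨Set.univ, IrreducibleSpace.isIrreducible_univ B, isClosed_univ⟩⟩
  have hbot : topologicalKrullDim B ≠ ⊥ := Order.krullDim_ne_bot_iff.2 hBne
  obtain ⟨d, hdB⟩ : ∃ d : ℕ, topologicalKrullDim B = d := by
    generalize topologicalKrullDim B = k at *
    induction k with
    | bot => exact absurd rfl hbot
    | coe k =>
      induction k with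
      | top => exact absurd rfl ht
      | coe k => exact ⟨k, rfl⟩
  have hA : (d : WithBot ℕ∞) ≤ Order.krullDim (IrreducibleCloseds A) :=
    (hd.trans hdB).ge
  obtain ⟨l, hl⟩ := Order.le_krullDim_iff.1 hA
  let l' := l.map _ (IrreducibleCloseds.map_strictMono_of_isInducing hf)
  let T : IrreducibleCloseds B :=
    ⟨Set.univ, IrreducibleSpace.isIrreducible_univ B, isClosed_univ⟩
  have hlt : l'.last < T := by
    have hsub : ((l'.last : IrreducibleCloseds B) : Set B) ⊆ closure (Set.range f) := by
      change closure (f '' _) ⊆ _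
      exact closure_mono (Set.image_subset_range _ _)
    refine lt_of_le_of_ne (fun x _ => Set.mem_univ x) ?_
    intro h
    apply hne
    rw [h] at hsub
    exact Set.univ_subset_iff.1 hsub
  have h2 := Order.LTSeries.length_le_krullDim (l'.snoc T hlt)
  have h3 : (l'.snoc T hlt).length = d + 1 := by
    rw [RelSeries.snoc_length]; simp [l', hl]
  rw [h3] at h2
  have h4 : ((d + 1 : ℕ) : WithBot ℕ∞) ≤ (d : WithBot ℕ∞) := h2.trans hdB.le
  have h5 : d + 1 ≤ d := by exact_mod_cast h4
  omega

/-- The prime ideal of a point. -/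
noncomputable def ptSpec (n : ℕ) (x : Fin n → ℂ) : PrimeSpectrum (MvPolynomial (Fin n) ℂ) :=
  ⟨RingHom.ker (MvPolynomial.eval x), RingHom.ker_isPrime _⟩

theorem zariski_eq_induced (n : ℕ) : zariskiTopology (Fin n) ℂ =
    TopologicalSpace.induced (ptSpec n) inferInstance := by
  rw [PrimeSpectrum.isTopologicalBasis_basic_opens.eq_generateFrom, induced_generateFrom_eq]
  unfold zariskiTopology
  congr 1
  ext U
  constructor
  · rintro ⟨p, rfl⟩
    exact ⟨_, ⟨p, rfl⟩, rfl⟩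
  · rintro ⟨_, ⟨p, rfl⟩, rfl⟩
    exact ⟨p, rfl⟩

theorem zariski_dim_le (n : ℕ) :
    @topologicalKrullDim _ (zariskiTopology (Fin n) ℂ) ≤ n := by
  let := zariskiTopology (Fin n) ℂ
  have hi : Topology.IsInducing (ptSpec n) := ⟨zariski_eq_induced n⟩
  refine hi.topologicalKrullDim_le.trans ?_
  rw [PrimeSpectrum.topologicalKrullDim_eq_ringKrullDim]
  simp

theorem exists_re_im {σ : Type*} (p : MvPolynomial σ ℂ) : ∃ a b : MvPolynomial σ ℝ,
    ∀ x : σ → ℝ, MvPolynomial.eval (fun i => (x i : ℂ)) p =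
      (MvPolynomial.eval x a : ℂ) + (MvPolynomial.eval x b : ℂ) * Complex.I := by
  induction p using MvPolynomial.induction_on with
  | C c => exact ⟨.C c.re, .C c.im, fun x => by simp⟩
  | add p q hp hq =>
    obtain ⟨a, b, h⟩ := hp
    obtain ⟨c, d, h'⟩ := hq
    exact ⟨a + c, b + d, fun x => by simp [h, h']; ring⟩
  | mul_X p i hp =>
    obtain ⟨a, b, h⟩ := hp
    exact ⟨a * .X i, b * .X i, fun x => by simp [h]; ring⟩

theorem eval_map_ofReal {σ : Type*} (p : MvPolynomial σ ℝ) (x : σ → ℝ) :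
    MvPolynomial.eval (fun i => (x i : ℂ)) (p.map Complex.ofRealHom) =
      (MvPolynomial.eval x p : ℂ) := by
  induction p using MvPolynomial.induction_on with
  | C c => simp
  | add p q hp hq => simp [hp, hq]
  | mul_X p i hp => simp [hp]

theorem real_zariski_eq_induced (n : ℕ) : zariskiTopology (Fin n) ℝ =
    TopologicalSpace.induced (fun (x : Fin n → ℝ) i => (x i : ℂ)) (zariskiTopology (Fin n) ℂ) := by
  apply le_antisymm
  · conv_rhs => rw [zariskiTopology, induced_generateFrom_eq]
    apply le_generateFrom
    rintro _ ⟨_, ⟨p, rfl⟩, rfl⟩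
    obtain ⟨a, b, h⟩ := exists_re_im p
    have : (fun (x : Fin n → ℝ) i => (x i : ℂ)) ⁻¹' {x | MvPolynomial.eval x p ≠ 0} =
        {x | MvPolynomial.eval x a ≠ 0} ∪ {x | MvPolynomial.eval x b ≠ 0} := by
      ext x
      simp only [Set.mem_preimage, Set.mem_ofPred_eq, Set.mem_union, h, ne_eq, Complex.ext_iff]
      simp
      tauto
    rw [this]
    let := zariskiTopology (Fin n) ℝ
    exact IsOpen.union (TopologicalSpace.isOpen_generateFrom_of_mem ⟨a, rfl⟩)
      (TopologicalSpace.isOpen_generateFrom_of_mem ⟨b, rfl⟩)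
  · conv_lhs => rw [zariskiTopology, induced_generateFrom_eq]
    apply le_generateFrom
    rintro _ ⟨p, rfl⟩
    apply TopologicalSpace.isOpen_generateFrom_of_mem
    refine ⟨_, ⟨p.map Complex.ofRealHom, rfl⟩, ?_⟩
    ext x
    change MvPolynomial.eval (fun i => (x i : ℂ)) (p.map Complex.ofRealHom) ≠ 0 ↔ MvPolynomial.eval x p ≠ 0
    rw [eval_map_ofReal, Complex.ofReal_ne_zero]

theorem zariski_isClosed_zeros (n : ℕ) (T : Set (MvPolynomial (Fin n) ℂ)) :
    @IsClosed _ (zariskiTopology (Fin n) ℂ) {x | ∀ p ∈ T, MvPolynomial.eval x p = 0} := by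
  let := zariskiTopology (Fin n) ℂ
  have : {x | ∀ p ∈ T, MvPolynomial.eval x p = 0} =
      ⋂ p ∈ T, {x : Fin n → ℂ | MvPolynomial.eval x p ≠ 0}ᶜ := by
    ext x; simp
  rw [this]
  refine isClosed_biInter fun p _ => ?_
  rw [isClosed_compl_iff]
  exact TopologicalSpace.isOpen_generateFrom_of_mem ⟨p, rfl⟩

/-- If a Zariski-closed `X ⊆ ℂ^n` is irreducible (complex
Zariski topology) and observable over the reals (the Krull dimension of
`X_ℝ = X ∩ ℝ^n` in the real Zariski topology equals that of `X` in the complex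
Zariski topology), then `X` is defined over the reals: `X` equals the complex
Zariski closure of `X_ℝ`. -/
theorem stmt_10 (n : ℕ) (X : Set (Fin n → ℂ))
    (hX : ∃ T : Set (MvPolynomial (Fin n) ℂ),
      X = {x | ∀ p ∈ T, MvPolynomial.eval x p = 0})
    (hirr : @IsIrreducible _ (zariskiTopology (Fin n) ℂ) X)
    (hobs : @topologicalKrullDim {x : Fin n → ℝ // (fun i => (x i : ℂ)) ∈ X}
        (TopologicalSpace.induced Subtype.val (zariskiTopology (Fin n) ℝ))
      = @topologicalKrullDim X
        (TopologicalSpace.induced Subtype.val (zariskiTopology (Fin n) ℂ))) :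
    X = @closure _ (zariskiTopology (Fin n) ℂ)
      (X ∩ {y : Fin n → ℂ | ∀ i, ∃ t : ℝ, y i = (t : ℂ)}) := by
  let tC : TopologicalSpace (Fin n → ℂ) := zariskiTopology (Fin n) ℂ
  let tR : TopologicalSpace (Fin n → ℝ) := zariskiTopology (Fin n) ℝ
  have hcl : IsClosed X := by
    obtain ⟨T, rfl⟩ := hX
    exact zariski_isClosed_zeros n T
  let tX : TopologicalSpace X := TopologicalSpace.induced Subtype.val tC
  let tA : TopologicalSpace {x : Fin n → ℝ // (fun i => (x i : ℂ)) ∈ X} :=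
    TopologicalSpace.induced Subtype.val tR
  let f : {x : Fin n → ℝ // (fun i => (x i : ℂ)) ∈ X} → X := fun x => ⟨_, x.2⟩
  have hval : Topology.IsInducing (Subtype.val : X → Fin n → ℂ) := ⟨rfl⟩
  have hf : Topology.IsInducing f := by
    rw [← hval.of_comp_iff]
    refine ⟨?_⟩
    change TopologicalSpace.induced Subtype.val (zariskiTopology (Fin n) ℝ) = _
    rw [real_zariski_eq_induced, induced_compose]
    rfl
  have : IrreducibleSpace X := isIrreducible_iff_irreducibleSpace.1 hirr
  have ht : topologicalKrullDim X ≠ ⊤ := by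
    have h1 : topologicalKrullDim X ≤ n := hval.topologicalKrullDim_le.trans (zariski_dim_le n)
    intro h
    rw [h] at h1
    have h2 : ((⊤ : ℕ∞) : WithBot ℕ∞) ≤ ((n : ℕ∞) : WithBot ℕ∞) := h1
    rw [WithBot.coe_le_coe, top_le_iff] at h2
    exact ENat.natCast_ne_top n h2
  have hdense := denseRange_of_dim_eq f hf hobs ht
  apply Set.Subset.antisymm
  · intro x hx
    have h1 : (⟨x, hx⟩ : X) ∈ closure (Set.range f) := by rw [hdense]; trivial
    rw [hval.closure_eq_preimage_closure_image] at h1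
    refine closure_mono ?_ h1
    rintro _ ⟨_, ⟨y, rfl⟩, rfl⟩
    exact ⟨y.2, fun i => ⟨y.1 i, rfl⟩⟩
  · exact closure_minimal Set.inter_subset_left hcl
end
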